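/- arXiv:1001.4470 — 5 statements merged into one kernel-verified Lean document; each statement's English description precedes it below -/
import Mathlib

section
/- For every irreducible polynomial Q ∈ B, the multiplicity of Q in the factorization of the Jacobian J in B equals e_Q − 1. Equivalently, up to a nonzero scalar, J is the product, over representatives Q of the ramified irreducible polynomials of B, of Q^{e_Q − 1}. -/
noncomputable section

open MvPolynomial

/-- The multiplicity of `Q` in the factorization of `P` equals `e`. -/
def MultIs {σ : Type} (Q P : MvPolynomial σ ℂ) (e : ℕ) : Prop :=
  Q ^ e ∣ P ∧ ¬ Q ^ (e + 1) ∣ P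

/-- The Jacobian `det (∂ f i / ∂ X j)` of an `n`-tuple of polynomials. -/
def Jac {n : ℕ} (f : Fin n → MvPolynomial (Fin n) ℂ) : MvPolynomial (Fin n) ℂ :=
  (Matrix.of fun i j : Fin n => pderiv j (f i)).det

/-- `RamIdx A Q e` : the contraction `QB ∩ A` is generated by an irreducible `P ∈ A`,
and `e` is the multiplicity of `Q` in the factorization of `P` in `B`. -/
def RamIdx {σ : Type} (A : Subalgebra ℂ (MvPolynomial σ ℂ))
    (Q : MvPolynomial σ ℂ) (e : ℕ) : Prop :=
  ∃ P : A, Irreducible P ∧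
    (Ideal.span {Q}).comap (algebraMap A (MvPolynomial σ ℂ)) = Ideal.span {P} ∧
    MultIs Q (P : MvPolynomial σ ℂ) e

/-- `Q` is a ramified irreducible of `B` over `A`. -/
def IsRamified {σ : Type} (A : Subalgebra ℂ (MvPolynomial σ ℂ))
    (Q : MvPolynomial σ ℂ) : Prop :=
  Irreducible Q ∧ ∃ e, RamIdx A Q e ∧ 1 < e

/-- `RamReps A S e` : `S` is a finite set of pairwise non-associated irreducible elements of `B`,
each ramified with ramification index `e Q`, and every ramified irreducible of `B` is associated
to exactly one element of `S`. -/
def RamReps {σ : Type} (A : Subalgebra ℂ (MvPolynomial σ ℂ))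
    (S : Finset (MvPolynomial σ ℂ)) (e : MvPolynomial σ ℂ → ℕ) : Prop :=
  (∀ Q ∈ S, Irreducible Q ∧ RamIdx A Q (e Q) ∧ 1 < e Q) ∧
  (∀ Q ∈ S, ∀ Q' ∈ S, Q ≠ Q' → ¬ Associated Q Q') ∧
  (∀ Q : MvPolynomial σ ℂ, IsRamified A Q → ∃! Q', Q' ∈ S ∧ Associated Q Q')

/-- The polynomial map `ℂⁿ → ℂⁿ` associated to an `n`-tuple of polynomials. -/
def polyMap {n : ℕ} (f : Fin n → MvPolynomial (Fin n) ℂ) : (Fin n → ℂ) → (Fin n → ℂ) :=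
  fun x i => eval x (f i)

/-- The branch locus: points whose fiber has fewer than `r` elements. -/
def branchLocus {n : ℕ} (f : Fin n → MvPolynomial (Fin n) ℂ) (r : ℕ) : Set (Fin n → ℂ) :=
  {u | (polyMap f ⁻¹' {u}).Finite ∧ (polyMap f ⁻¹' {u}).ncard < r}

end
namespace MvPolynomial

variable {σ R : Type*} [CommRing R]

/-- In characteristic zero, a nonconstant polynomial does not divide all of its partial
derivatives. -/
theorem exists_not_dvd_pderiv [IsDomain R] [CharZero R] {p : MvPolynomial σ R}
    (hp : p.totalDegree ≠ 0) : ∃ i, ¬ p ∣ pderiv i p := by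
  have hp0 : p ≠ 0 := by rintro rfl; simp at hp
  obtain ⟨m, hm, i, hi⟩ : ∃ m ∈ p.support, ∃ i, m i ≠ 0 := by
    by_contra! h
    exact hp ((totalDegree_eq_zero_iff _ p).2 fun m hm i => h m hm i)
  refine ⟨i, ?_⟩
  rintro ⟨c, hc⟩
  have hne : pderiv i p ≠ 0 := by
    intro h0
    have h1 := coeff_pderiv (i := i) p (m - Finsupp.single i 1)
    have h2 : m - Finsupp.single i 1 + Finsupp.single i 1 = m :=
      tsub_add_cancel_of_le (by simpa [Nat.one_le_iff_ne_zero] using hi)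
    rw [h0, coeff_zero, h2] at h1
    rcases mul_eq_zero.1 h1.symm with h | h
    · exact (mem_support_iff.1 hm) h
    · exact (Nat.cast_add_one_ne_zero (R := R) _) h
  have hc0 : c ≠ 0 := by rintro rfl; simp [hc] at hne
  have hlt : (pderiv i p).totalDegree < p.totalDegree := by
    rw [totalDegree, Finset.sup_lt_iff (by simpa using Nat.pos_of_ne_zero hp)]
    intro m' hm'
    have hmem : m' + Finsupp.single i 1 ∈ p.support := by
      rw [mem_support_iff] at hm' ⊢
      rw [coeff_pderiv] at hm'
      exact left_ne_zero_of_mul hm'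
    have := le_totalDegree hmem
    rw [Finsupp.sum_add_index' (by simp) (by simp)] at this
    simp at this
    omega
  rw [hc, totalDegree_mul_of_isDomain hp0 hc0] at hlt
  omega

/-- The chain rule for a derivation applied to a polynomial expression. -/
theorem derivation_aeval {S M : Type*} [Fintype σ] [CommRing S] [Algebra R S] [AddCommGroup M]
    [Module R M] [Module S M] [IsScalarTower R S M] (D : Derivation R S M) (f : σ → S)
    (p : MvPolynomial σ R) :
    D (aeval f p) = ∑ i, aeval f (pderiv i p) • D (f i) := by
  classical
  induction p using MvPolynomial.induction_on with
  | C a => simp [← algebraMap_eq]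
  | add p q hp hq => simp [hp, hq, add_smul, Finset.sum_add_distrib]
  | mul_X p j hp =>
    have hsum : ∑ i, aeval f (Pi.single (M := fun _ => MvPolynomial σ R) i p j) • D (f i) =
        aeval f p • D (f j) := by
      rw [Finset.sum_eq_single j (fun i _ hi => by simp [hi.symm]) (by simp)]
      simp
    simp only [Pi.single_apply] at hsum
    simp [hp, add_smul, Finset.sum_add_distrib, Finset.smul_sum, Pi.single_apply, smul_smul,
      mul_comm, hsum, add_comm]

end MvPolynomial

/-- A derivation into a field of characteristic zero that factors through the image of the source
and vanishes on a subring over which the source is integral is zero. -/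
theorem Derivation.eq_zero_of_isIntegral {k R S L : Type*} [CommRing k] [CommRing R] [CommRing S]
    [Field L] [CharZero L] [Algebra k S] [Algebra R S] [Algebra.IsIntegral R S] [Algebra S L]
    [Module k L] (D : Derivation k S L)
    (hker : ∀ s, algebraMap S L s = 0 → D s = 0) (hR : ∀ r, D (algebraMap R S r) = 0) :
    D = 0 := by
  ext b
  let φ : R →+* L := (algebraMap S L).comp (algebraMap R S)
  let β : L := algebraMap S L b
  have hφ (g : Polynomial R) : algebraMap S L (Polynomial.aeval b g) = (g.map φ).eval β := by
    rw [Polynomial.eval_map, Polynomial.aeval_def, Polynomial.hom_eval₂]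
  have hchain (g : Polynomial R) :
      D (Polynomial.aeval b g) = Polynomial.aeval b (Polynomial.derivative g) • D b := by
    induction g using Polynomial.induction_on' with
    | add p q hp hq => simp [hp, hq, add_smul]
    | monomial n a =>
      simp [Polynomial.aeval_monomial, Polynomial.derivative_monomial, hR, mul_smul,
        Derivation.leibniz_pow, Nat.cast_smul_eq_nsmul]
  have key : ∀ (d : ℕ) (g : Polynomial R), (g.map φ).natDegree ≤ d → g.map φ ≠ 0 →
      (g.map φ).eval β = 0 → ∃ h : Polynomial R, (h.map φ).eval β = 0 ∧
        ((Polynomial.derivative h).map φ).eval β ≠ 0 := by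
    intro d
    induction d with
    | zero =>
      intro g hd h0 hr
      rw [Polynomial.eq_C_of_natDegree_le_zero hd] at h0 hr
      simp_all
    | succ d ih =>
      intro g hd h0 hr
      by_cases hg : ((Polynomial.derivative g).map φ).eval β = 0
      · have hdeg : (g.map φ).natDegree ≠ 0 := by
          intro h
          rw [Polynomial.eq_C_of_natDegree_eq_zero h] at h0 hr
          simp_all
        rw [← Polynomial.derivative_map] at hg
        refine ih (Polynomial.derivative g) ?_ ?_ ?_
        · rw [← Polynomial.derivative_map]
          have := Polynomial.natDegree_derivative_lt hdeg
          omega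
        · rw [← Polynomial.derivative_map]
          intro h
          exact hdeg (Polynomial.derivative_eq_zero.1 h)
        · rwa [← Polynomial.derivative_map]
      · exact ⟨g, hr, hg⟩
  obtain ⟨g, hg, hgb⟩ := Algebra.IsIntegral.isIntegral (R := R) b
  have hgb' : (g.map φ).eval β = 0 := by
    rw [← hφ, Polynomial.aeval_def, hgb, map_zero]
  obtain ⟨h, h1, h2⟩ := key _ g le_rfl (hg.map φ).ne_zero hgb'
  rw [← hφ] at h1 h2
  have h3 := hchain h
  rw [hker _ h1, Algebra.smul_def] at h3
  simpa using (mul_eq_zero.1 h3.symm).resolve_left h2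

/-- The contraction of a principal prime under an integral extension of unique factorization
domains is generated by an irreducible element. -/
theorem exists_irreducible_comap_span_eq {A B : Type*} [CommRing A] [IsDomain A]
    [UniqueFactorizationMonoid A] [CommRing B] [IsDomain B] [UniqueFactorizationMonoid B]
    [Algebra A B] [FaithfulSMul A B] [Algebra.IsIntegral A B] {Q : B} (hQ : Irreducible Q) :
    ∃ P : A, Irreducible P ∧ (Ideal.span {Q}).comap (algebraMap A B) = Ideal.span {P} := by
  have hQp : (Ideal.span {Q}).IsPrime := (Ideal.span_singleton_prime hQ.ne_zero).2 hQ.prime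
  have hne : (Ideal.span {Q}).comap (algebraMap A B) ≠ ⊥ :=
    Ideal.comap_ne_bot_of_integral_mem hQ.ne_zero (Ideal.mem_span_singleton_self Q)
      (Algebra.IsIntegral.isIntegral Q)
  have hp : ((Ideal.span {Q}).comap (algebraMap A B)).IsPrime := Ideal.comap_isPrime _ _
  obtain ⟨P, hPmem, hP⟩ := hp.exists_mem_prime_of_ne_bot hne
  have hPp : (Ideal.span {P}).IsPrime := (Ideal.span_singleton_prime hP.ne_zero).2 hP
  refine ⟨P, hP.irreducible, ?_⟩
  by_contra hcon
  have hlt : Ideal.span {P} < (Ideal.span {Q}).comap (algebraMap A B) :=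
    lt_of_le_of_ne ((Ideal.span_singleton_le_iff_mem _).2 hPmem) (Ne.symm hcon)
  have : (Ideal.span {Q}).LiesOver ((Ideal.span {Q}).comap (algebraMap A B)) := ⟨rfl⟩
  obtain ⟨q, hq, hqp, hqP⟩ := Ideal.exists_ideal_lt_liesOver_of_lt (Ideal.span {Q}) hlt
  have hq0 : q ≠ ⊥ := by
    rintro rfl
    have h1 : P ∈ (⊥ : Ideal B).under A := by
      rw [← hqP.over]; exact Ideal.mem_span_singleton_self P
    have h2 : algebraMap A B P = 0 := by simpa [Ideal.under] using h1
    exact hP.ne_zero ((FaithfulSMul.algebraMap_injective A B) (by simpa using h2))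
  obtain ⟨Q', hQ'mem, hQ'⟩ := hqp.exists_mem_prime_of_ne_bot hq0
  have h1 : Q ∣ Q' := Ideal.mem_span_singleton.1 (hq.le hQ'mem)
  have h2 : Q' ∣ Q := (hQ.associated_of_dvd hQ'.irreducible h1).symm.dvd
  exact hq.not_ge ((Ideal.span_singleton_le_iff_mem _).2 (q.mem_of_dvd h2 hQ'mem))

open MvPolynomial

section Jacobian

variable {n : ℕ} {f : Fin n → MvPolynomial (Fin n) ℂ}

theorem det_updateRow_pderiv_aeval (i : Fin n) (p : MvPolynomial (Fin n) ℂ) :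
    ((Matrix.of fun i j : Fin n => pderiv j (f i)).updateRow i
      fun j => pderiv j (aeval f p)).det = aeval f (pderiv i p) * Jac f := by
  rw [Jac, ← smul_eq_mul, ← Matrix.det_updateRow_sum _ i fun k => aeval f (pderiv k p)]
  congr 2
  ext1 j
  rw [derivation_aeval (pderiv j) f p]
  simp

/-- The gradients of `Q` and of all the `f j` but one are independent modulo `Q`, if the partial
derivative at the remaining index of a relation modulo `Q` between the `f j` is not divisible
by `Q`. -/
theorem not_dvd_det_updateRow_pderiv {Q p : MvPolynomial (Fin n) ℂ} (hQ : Irreducible Q)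
    [Algebra.IsIntegral (Algebra.adjoin ℂ (Set.range f)) (MvPolynomial (Fin n) ℂ)] {i : Fin n}
    (hp : Q ∣ aeval f p) (hpi : ¬ Q ∣ aeval f (pderiv i p)) :
    ¬ Q ∣ ((Matrix.of fun i j : Fin n => pderiv j (f i)).updateRow i
      fun j => pderiv j Q).det := by
  intro hdvd
  have hQp : (Ideal.span {Q}).IsPrime := (Ideal.span_singleton_prime hQ.ne_zero).2 hQ.prime
  let L := FractionRing (MvPolynomial (Fin n) ℂ ⧸ Ideal.span {Q})
  have hL (g : MvPolynomial (Fin n) ℂ) : algebraMap _ L g = 0 ↔ Q ∣ g := by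
    rw [IsScalarTower.algebraMap_apply _ (MvPolynomial (Fin n) ℂ ⧸ Ideal.span {Q}) L,
      FaithfulSMul.algebraMap_eq_zero_iff (MvPolynomial (Fin n) ℂ ⧸ Ideal.span {Q}) L, Ideal.Quotient.algebraMap_eq,
      Ideal.Quotient.eq_zero_iff_mem, Ideal.mem_span_singleton]
  have : CharZero L := algebraRat.charZero L
  set M := (Matrix.of fun i j : Fin n => pderiv j (f i)).updateRow i fun j => pderiv j Q with hM
  have hdet : ((algebraMap _ L).mapMatrix M).det = 0 := by
    rw [← RingHom.map_det]; exact (hL _).2 hdvd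
  obtain ⟨v, hv0, hv⟩ := Matrix.exists_mulVec_eq_zero_iff.2 hdet
  let D : Derivation ℂ (MvPolynomial (Fin n) ℂ) L := mkDerivation ℂ v
  have hD (g : MvPolynomial (Fin n) ℂ) : D g = ∑ j, algebraMap _ L (pderiv j g) * v j := by
    have h := derivation_aeval D X g
    simp only [aeval_X_left, AlgHom.id_apply] at h
    rw [h]
    simp [D, mkDerivation_X, Algebra.smul_def]
  have hrow (k : Fin n) : ∑ j, algebraMap _ L (M k j) * v j = 0 := by
    simpa [Matrix.mulVec, dotProduct] using congrFun hv k
  have hDQ : D Q = 0 := by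
    rw [hD]; simpa [hM] using hrow i
  have hDf' (k : Fin n) (hk : k ≠ i) : D (f k) = 0 := by
    rw [hD]; simpa [hM, Matrix.updateRow_ne hk] using hrow k
  have hker (g : MvPolynomial (Fin n) ℂ) (hg : algebraMap _ L g = 0) : D g = 0 := by
    obtain ⟨c, rfl⟩ := (hL g).1 hg
    rw [D.leibniz, hDQ, smul_zero, add_zero, Algebra.smul_def, (hL Q).2 dvd_rfl, zero_mul]
  have hDf (k : Fin n) : D (f k) = 0 := by
    by_cases hk : k = i
    · subst hk
      have h := derivation_aeval D f p
      rw [hker _ ((hL _).2 hp), Finset.sum_eq_single k (fun j _ hj => by rw [hDf' j hj, smul_zero])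
        (fun hk => (hk (Finset.mem_univ k)).elim), Algebra.smul_def] at h
      exact (mul_eq_zero.1 h.symm).resolve_left fun h' => hpi ((hL _).1 h')
    · exact hDf' k hk
  have hDA (r : Algebra.adjoin ℂ (Set.range f)) :
      D (algebraMap _ (MvPolynomial (Fin n) ℂ) r) = 0 := by
    obtain ⟨r, hr⟩ := r
    rw [Algebra.adjoin_range_eq_range_aeval] at hr
    obtain ⟨q, rfl⟩ := hr
    change D (aeval f q) = 0
    rw [derivation_aeval D f q]
    simp [hDf]
  have hD0 := D.eq_zero_of_isIntegral hker hDA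
  refine hv0 (funext fun j => ?_)
  rw [← mkDerivation_X ℂ v j]
  exact congrArg (fun E : Derivation ℂ (MvPolynomial (Fin n) ℂ) L => E (X j)) hD0

/-- A finite polynomial extension of `ℂ`-algebras generated by `n` elements in `n` variables has
algebraically independent generators. -/
theorem algebraicIndependent_of_isIntegral_adjoin
    [Algebra.IsIntegral (Algebra.adjoin ℂ (Set.range f)) (MvPolynomial (Fin n) ℂ)] :
    AlgebraicIndependent ℂ f :=
  (Algebra.IsAlgebraic.isTranscendenceBasis_of_le_trdeg_of_finite ℂ f
    (by rw [MvPolynomial.trdeg_of_isDomain]; simp)).1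

theorem multIs_jac_of_ramIdx
    [Algebra.IsIntegral (Algebra.adjoin ℂ (Set.range f)) (MvPolynomial (Fin n) ℂ)]
    {Q : MvPolynomial (Fin n) ℂ} (hQ : Irreducible Q) {e : ℕ}
    (h : RamIdx (Algebra.adjoin ℂ (Set.range f)) Q e) : MultIs Q (Jac f) (e - 1) := by
  obtain ⟨P, hP, hcomap, hdvd, hndvd⟩ := h
  have hf : Function.Injective (aeval f : MvPolynomial (Fin n) ℂ →ₐ[ℂ] _) :=
    algebraicIndependent_of_isIntegral_adjoin
  have hmem (q : MvPolynomial (Fin n) ℂ) : aeval f q ∈ Algebra.adjoin ℂ (Set.range f) := by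
    rw [Algebra.adjoin_range_eq_range_aeval]; exact ⟨q, rfl⟩
  obtain ⟨p, hp⟩ : ∃ p, aeval f p = (P : MvPolynomial (Fin n) ℂ) := by
    exact (Algebra.adjoin_range_eq_range_aeval ℂ f).le P.2
  have hQdvd (q : MvPolynomial (Fin n) ℂ) : Q ∣ aeval f q ↔ p ∣ q := by
    have h1 : (⟨aeval f q, hmem q⟩ : Algebra.adjoin ℂ (Set.range f)) ∈
        (Ideal.span {Q}).comap (algebraMap _ (MvPolynomial (Fin n) ℂ)) ↔ Q ∣ aeval f q := by
      rw [Ideal.mem_comap, Ideal.mem_span_singleton]; rfl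
    rw [← h1, hcomap, Ideal.mem_span_singleton]
    constructor
    · rintro ⟨⟨c, hc⟩, h⟩
      rw [Algebra.adjoin_range_eq_range_aeval] at hc
      obtain ⟨c, rfl⟩ := hc
      refine ⟨c, hf ?_⟩
      rw [map_mul, hp]
      exact congrArg Subtype.val h
    · rintro ⟨c, rfl⟩
      refine ⟨⟨aeval f c, hmem c⟩, Subtype.ext ?_⟩
      change aeval f (p * c) = (P : MvPolynomial (Fin n) ℂ) * aeval f c
      rw [map_mul, hp]
  have hQP : Q ∣ aeval f p := (hQdvd p).2 dvd_rfl
  have hdeg : p.totalDegree ≠ 0 := by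
    intro h0
    rw [totalDegree_eq_zero_iff_eq_C] at h0
    have hc : coeff 0 p ≠ 0 := by
      intro hc
      rw [hc, C_0] at h0
      exact hP.ne_zero (Subtype.ext (by simp [← hp, h0]))
    rw [h0, ← algebraMap_eq, AlgHom.commutes] at hQP
    exact hQ.not_isUnit (isUnit_of_dvd_unit hQP ((isUnit_iff_ne_zero.2 hc).map _))
  obtain ⟨i, hi⟩ := exists_not_dvd_pderiv hdeg
  have hpi : ¬ Q ∣ aeval f (pderiv i p) := fun h => hi ((hQdvd _).1 h)
  obtain ⟨e, rfl⟩ : ∃ d, e = d + 1 := by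
    refine Nat.exists_eq_succ_of_ne_zero ?_
    rintro rfl
    exact hndvd (by rwa [zero_add, pow_one, ← hp])
  obtain ⟨u, hu⟩ := hdvd
  have hQu : ¬ Q ∣ u := by
    rintro ⟨w, rfl⟩
    exact hndvd ⟨w, by rw [hu]; ring⟩
  set M := Matrix.of fun i j : Fin n => pderiv j (f i)
  have hdet : aeval f (pderiv i p) * Jac f = Q ^ e * (((e + 1 : ℕ) * u) *
      (M.updateRow i fun j => pderiv j Q).det + Q * (M.updateRow i fun j => pderiv j u).det) := by
    rw [← det_updateRow_pderiv_aeval, hp, hu, ← Matrix.det_updateRow_smul,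
      ← Matrix.det_updateRow_smul, ← Matrix.det_updateRow_add, ← Matrix.det_updateRow_smul]
    congr 2
    ext1 j
    simp
    ring
  have hcop : IsRelPrime (aeval f (pderiv i p)) Q :=
    ((hQ.isRelPrime_iff_not_dvd).2 hpi).symm
  refine ⟨?_, ?_⟩
  · exact (hcop.symm.pow_left (m := e)).dvd_of_dvd_mul_left ⟨_, hdet⟩
  · intro h
    have h1 : Q ^ e * Q ∣ aeval f (pderiv i p) * Jac f := by
      rw [← pow_succ]; exact h.mul_left _
    rw [hdet, mul_dvd_mul_iff_left (pow_ne_zero _ hQ.ne_zero),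
      dvd_add_left (dvd_mul_right _ _)] at h1
    rcases hQ.prime.dvd_or_dvd h1 with h2 | h2
    · rcases hQ.prime.dvd_or_dvd h2 with h3 | h3
      · refine hQ.not_isUnit (isUnit_of_dvd_unit h3 ?_)
        have : ((e + 1 : ℕ) : MvPolynomial (Fin n) ℂ) = algebraMap ℂ _ (e + 1 : ℕ) := by simp
        rw [this]
        exact (isUnit_iff_ne_zero.2 (Nat.cast_ne_zero.2 e.succ_ne_zero)).map _
      · exact hQu h3
    · exact not_dvd_det_updateRow_pderiv hQ hQP hpi h2

theorem exists_ramIdx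
    [Algebra.IsIntegral (Algebra.adjoin ℂ (Set.range f)) (MvPolynomial (Fin n) ℂ)]
    {Q : MvPolynomial (Fin n) ℂ} (hQ : Irreducible Q) :
    ∃ e, RamIdx (Algebra.adjoin ℂ (Set.range f)) Q e := by
  have hf : AlgebraicIndependent ℂ f := algebraicIndependent_of_isIntegral_adjoin
  have : UniqueFactorizationMonoid (Algebra.adjoin ℂ (Set.range f)) :=
    hf.aevalEquiv.toMulEquiv.uniqueFactorizationMonoid inferInstance
  obtain ⟨P, hP, hcomap⟩ :=
    exists_irreducible_comap_span_eq (A := Algebra.adjoin ℂ (Set.range f)) hQ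
  have hfin : FiniteMultiplicity Q (P : MvPolynomial (Fin n) ℂ) :=
    FiniteMultiplicity.of_not_isUnit hQ.not_isUnit (by simpa using hP.ne_zero)
  exact ⟨multiplicity Q (P : MvPolynomial (Fin n) ℂ), P, hP, hcomap, pow_multiplicity_dvd _ _,
    hfin.not_pow_dvd_of_multiplicity_lt (Nat.lt_succ_self _)⟩

theorem associated_jac_prod_of_ramReps
    [Algebra.IsIntegral (Algebra.adjoin ℂ (Set.range f)) (MvPolynomial (Fin n) ℂ)]
    {S : Finset (MvPolynomial (Fin n) ℂ)} {e : MvPolynomial (Fin n) ℂ → ℕ}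
    (h : RamReps (Algebra.adjoin ℂ (Set.range f)) S e) (h0 : Jac f ≠ 0) :
    Associated (Jac f) (∏ Q ∈ S, Q ^ (e Q - 1)) := by
  obtain ⟨hS, hpair, hrep⟩ := h
  have hmult (Q) (hQ : Q ∈ S) : MultIs Q (Jac f) (e Q - 1) :=
    multIs_jac_of_ramIdx (hS Q hQ).1 (hS Q hQ).2.1
  obtain ⟨c, hc⟩ : ∏ Q ∈ S, Q ^ (e Q - 1) ∣ Jac f := by
    refine Finset.prod_dvd_of_isRelPrime (fun Q hQ Q' hQ' hne => ?_) fun Q hQ => (hmult Q hQ).1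
    refine IsRelPrime.pow (((hS Q hQ).1.isRelPrime_iff_not_dvd).2 fun hd => ?_)
    exact hpair Q hQ Q' hQ' hne ((hS Q hQ).1.associated_of_dvd (hS Q' hQ').1 hd)
  suffices hu : IsUnit c by
    rw [hc]; exact associated_mul_unit_left _ _ hu
  by_contra hu
  have hc0 : c ≠ 0 := by rintro rfl; simp [hc] at h0
  obtain ⟨q, hq, hqc⟩ := WfDvdMonoid.exists_irreducible_factor hu hc0
  obtain ⟨d, hd⟩ := exists_ramIdx (f := f) hq
  have hd1 : 1 < d := by
    by_contra! hle
    refine (multIs_jac_of_ramIdx hq hd).2 ?_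
    rw [Nat.sub_eq_zero_of_le hle, zero_add, pow_one, hc]
    exact hqc.mul_left _
  obtain ⟨Q, ⟨hQS, hqQ⟩, -⟩ := hrep q ⟨hq, d, hd, hd1⟩
  refine (hmult Q hQS).2 ?_
  rw [hc, pow_succ]
  exact mul_dvd_mul (Finset.dvd_prod_of_mem (fun Q => Q ^ (e Q - 1)) hQS) (hqQ.symm.dvd.trans hqc)

end Jacobian

open MvPolynomial in
theorem jacobian_factorisation {n : ℕ} (hn : 0 < n)
    (b : Fin n → ℕ) (hb : ∀ i, 0 < b i) (a : Fin n → ℕ)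
    (f : Fin n → MvPolynomial (Fin n) ℂ)
    (hhom : ∀ i, IsWeightedHomogeneous b (f i) (a i))
    (A : Subalgebra ℂ (MvPolynomial (Fin n) ℂ))
    (hA : A = Algebra.adjoin ℂ (Set.range f))
    (hfin : Module.Finite A (MvPolynomial (Fin n) ℂ)) :
    (∀ Q : MvPolynomial (Fin n) ℂ, Irreducible Q →
      ∀ e : ℕ, RamIdx A Q e → MultIs Q (Jac f) (e - 1)) ∧
    (∀ (S : Finset (MvPolynomial (Fin n) ℂ)) (eIdx : MvPolynomial (Fin n) ℂ → ℕ),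
      RamReps A S eIdx → Associated (Jac f) (∏ Q ∈ S, Q ^ (eIdx Q - 1))) := by
  subst hA
  have hAB := Algebra.IsIntegral.of_finite (Algebra.adjoin ℂ (Set.range f))
    (MvPolynomial (Fin n) ℂ)
  refine ⟨fun Q hQ e he => multIs_jac_of_ramIdx hQ he, fun S e hS =>
    associated_jac_prod_of_ramReps hS ?_⟩
  have hX : Irreducible (X ⟨0, hn⟩ : MvPolynomial (Fin n) ℂ) := (X_prime).irreducible
  obtain ⟨e, he⟩ := exists_ramIdx (f := f) hX
  intro h0
  exact (multIs_jac_of_ramIdx hX he).2 (h0 ▸ dvd_zero _)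
end

section
/- The image of the ramification locus under f equals the branch locus: f(Z(J)) = U_branch. -/
namespace MvPolynomial

section Taylor

variable {σ K : Type*} [Field K]

/-- First-order Taylor expansion at `x`, modulo the square of the maximal ideal of `x`. -/
theorem sub_C_eval_sub_sum_pderiv_mem_sq [Fintype σ] (x : σ → K)
    (p : MvPolynomial σ K) :
    p - C (eval x p) - ∑ j, C (eval x (pderiv j p)) * (X j - C (x j)) ∈
      RingHom.ker (eval x) ^ 2 := by
  classical
  have hX : ∀ j, X j - C (x j) ∈ RingHom.ker (eval x) := fun j => by simp [RingHom.mem_ker]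
  induction p using MvPolynomial.induction_on with
  | C c => simp
  | add p q hp hq =>
    convert add_mem hp hq using 1
    simp only [map_add, add_mul, Finset.sum_add_distrib]
    ring
  | mul_X p i hp =>
    have hpx : p - C (eval x p) ∈ RingHom.ker (eval x) := by simp [RingHom.mem_ker]
    have h₁ := Ideal.mul_mem_right (C (x i)) _ hp
    have h₂ := Ideal.mul_mem_mul hpx (hX i)
    rw [← pow_two] at h₂
    convert add_mem h₁ h₂ using 1
    have hsum : ∑ j, C (eval x (pderiv j (p * X i))) * (X j - C (x j)) =
        (∑ j, C (eval x (pderiv j p)) * (X j - C (x j))) * C (x i) +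
          C (eval x p) * (X i - C (x i)) := by
      have : ∀ j, C (eval x (pderiv j (p * X i))) * (X j - C (x j)) =
          C (eval x (pderiv j p)) * (X j - C (x j)) * C (x i) +
            if j = i then C (eval x p) * (X i - C (x i)) else 0 := by
        intro j
        rcases eq_or_ne j i with rfl | h
        · simp only [pderiv_mul, pderiv_X_self, map_add, map_mul, eval_X, if_true, mul_one]
          ring
        · simp only [pderiv_mul, pderiv_X_of_ne h.symm, map_mul, eval_X, if_neg h, mul_zero,
            add_zero]
          ring
      simp only [this, Finset.sum_add_distrib, Finset.sum_ite_eq', Finset.mem_univ, if_true,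
        ← Finset.sum_mul]
    rw [hsum]
    simp only [map_mul, eval_X]
    ring

/-- Finitely many points can be separated by polynomials. -/
theorem exists_eval_eq_one_and_eq_zero (s : Finset (σ → K)) (x : σ → K)
    (hx : x ∉ s) : ∃ p : MvPolynomial σ K, eval x p = 1 ∧ ∀ y ∈ s, eval y p = 0 := by
  classical
  induction s using Finset.induction_on with
  | empty => exact ⟨1, by simp⟩
  | insert y s _ ih =>
    simp only [Finset.mem_insert, not_or] at hx
    obtain ⟨p, hpx, hp⟩ := ih hx.2
    obtain ⟨j, hj⟩ := Function.ne_iff.1 hx.1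
    have hj' : x j - y j ≠ 0 := sub_ne_zero.2 hj
    refine ⟨C (x j - y j)⁻¹ * (X j - C (y j)) * p, ?_, ?_⟩
    · simp only [map_mul, map_sub, eval_C, eval_X, hpx, mul_one]
      exact inv_mul_cancel₀ hj'
    · intro z hz
      rcases Finset.mem_insert.1 hz with rfl | hz
      · simp
      · simp [hp z hz]

/-- The restriction of polynomial functions to a set of points. -/
noncomputable def evalOn (S : Set (σ → K)) : MvPolynomial σ K →ₗ[K] (S → K) :=
  LinearMap.pi fun x => (aeval (x : σ → K)).toLinearMap

theorem evalOn_apply (S : Set (σ → K)) (p : MvPolynomial σ K) (x : S) :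
    evalOn S p x = eval (x : σ → K) p := by
  simp [evalOn, aeval_eq_eval]

theorem evalOn_surjective (S : Set (σ → K)) [Finite S] :
    Function.Surjective (evalOn S) := by
  classical
  have := Fintype.ofFinite S
  have (x : S) : ∃ p : MvPolynomial σ K, evalOn S p = Pi.single x 1 := by
    obtain ⟨p, hp, hp'⟩ := exists_eval_eq_one_and_eq_zero (S.toFinset.erase x) x.1 (by simp)
    refine ⟨p, ?_⟩
    ext y
    rw [evalOn_apply]
    rcases eq_or_ne y x with rfl | h
    · simpa using hp
    · rw [Pi.single_eq_of_ne h]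
      exact hp' _ (by simpa [Subtype.ext_iff] using h)
  choose p hp using this
  intro g
  refine ⟨∑ x, g x • p x, ?_⟩
  simp only [map_sum, map_smul, hp]
  ext x
  simp [Finset.sum_apply, Pi.single_apply]

end Taylor

section Fiber

variable {σ K ι : Type*} [Field K]

/-- The ideal of the scheme-theoretic fibre over `u` of the map defined by `f`. -/
noncomputable def fiberIdeal (f : ι → MvPolynomial σ K) (u : ι → K) : Ideal (MvPolynomial σ K) :=
  Ideal.span (Set.range fun i => f i - C (u i))

/-- The points of the fibre over `u` of the map defined by `f`. -/
def fiber (f : ι → MvPolynomial σ K) (u : ι → K) : Set (σ → K) :=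
  {x | ∀ i, eval x (f i) = u i}

theorem sub_C_mem_fiberIdeal (f : ι → MvPolynomial σ K) (u : ι → K) (i : ι) :
    f i - C (u i) ∈ fiberIdeal f u :=
  Ideal.subset_span ⟨i, rfl⟩

theorem fiberIdeal_le_ker_eval_iff {f : ι → MvPolynomial σ K} {u : ι → K}
    {x : σ → K} : fiberIdeal f u ≤ RingHom.ker (eval x) ↔ x ∈ fiber f u := by
  simp [fiberIdeal, Ideal.span_le, Set.range_subset_iff, fiber, RingHom.mem_ker, sub_eq_zero]

/-- Restriction to finitely many points of a fibre factors through the coordinate ring of the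
fibre. -/
theorem exists_surjective_comp_eq_evalOn {V : Type*} [AddCommGroup V] [Module K V]
    {f : ι → MvPolynomial σ K} {u : ι → K} {ψ : MvPolynomial σ K →ₗ[K] V}
    (hψ : Function.Surjective ψ)
    (hker : LinearMap.ker ψ = (fiberIdeal f u).restrictScalars K)
    {S : Set (σ → K)} [Finite S] (hS : S ⊆ fiber f u) :
    ∃ L : V →ₗ[K] (S → K), Function.Surjective L ∧ ∀ p, L (ψ p) = evalOn S p := by
  have hle : LinearMap.ker ψ ≤ LinearMap.ker (evalOn S) := by
    rw [hker]
    intro p hp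
    rw [LinearMap.mem_ker]
    ext x
    rw [evalOn_apply]
    exact fiberIdeal_le_ker_eval_iff.2 (hS x.2) hp
  let e := ψ.quotKerEquivOfSurjective hψ
  have hL : ∀ p, ((LinearMap.ker ψ).liftQ _ hle ∘ₗ e.symm.toLinearMap) (ψ p) = evalOn S p := by
    intro p
    have : e.symm (ψ p) = (LinearMap.ker ψ).mkQ p := by
      rw [LinearEquiv.symm_apply_eq]
      rfl
    simp [this]
  refine ⟨_, fun g => ?_, hL⟩
  obtain ⟨p, rfl⟩ := evalOn_surjective S g
  exact ⟨_, hL p⟩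

/-- If `f` is a family of algebraically independent polynomials such that the polynomial ring is
free of finite rank over the subalgebra they generate, then that rank is the dimension of
the coordinate ring of every fibre. -/
theorem exists_linearMap_ker_eq_fiberIdeal {f : ι → MvPolynomial σ K}
    (hf : AlgebraicIndependent K f)
    [Module.Finite (Algebra.adjoin K (Set.range f)) (MvPolynomial σ K)]
    [Module.Free (Algebra.adjoin K (Set.range f)) (MvPolynomial σ K)] (u : ι → K) :
    ∃ ψ : MvPolynomial σ K →ₗ[K]
        (Fin (Module.finrank (Algebra.adjoin K (Set.range f)) (MvPolynomial σ K)) → K),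
      Function.Surjective ψ ∧ LinearMap.ker ψ = (fiberIdeal f u).restrictScalars K := by
  set A := Algebra.adjoin K (Set.range f)
  let B := Module.finBasis A (MvPolynomial σ K)
  let φ : A →ₐ[K] K := (aeval u).comp hf.repr
  have hφ : ∀ c : A, φ c = 0 → (c : MvPolynomial σ K) ∈ fiberIdeal f u := by
    intro c hc
    have h : ((Ideal.Quotient.mkₐ K (fiberIdeal f u)).comp (aeval f)) =
        (Algebra.ofId K _).comp (aeval u) := by
      ext i
      simp only [AlgHom.comp_apply, aeval_X, Algebra.ofId_apply]
      refine Ideal.Quotient.eq.2 (sub_C_mem_fiberIdeal f u i)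
    have := DFunLike.congr_fun h (hf.repr c)
    simp only [AlgHom.comp_apply, hf.aeval_repr] at this
    refine Ideal.Quotient.eq_zero_iff_mem.1 (this.trans ?_)
    change Algebra.ofId K _ (φ c) = 0
    rw [hc, map_zero]
  let ψ : MvPolynomial σ K →ₗ[K] (Fin (Module.finrank A (MvPolynomial σ K)) → K) :=
    LinearMap.pi fun i => φ.toLinearMap ∘ₗ (B.coord i).restrictScalars K
  have hψ : ∀ p i, ψ p i = φ (B.repr p i) := fun _ _ => rfl
  refine ⟨ψ, fun g => ⟨∑ i, algebraMap K A (g i) • B i, ?_⟩, le_antisymm ?_ ?_⟩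
  · ext i
    rw [hψ, B.repr_sum_self, AlgHom.commutes]
    rfl
  · intro p hp
    rw [Submodule.restrictScalars_mem, ← B.sum_repr p]
    refine sum_mem fun i _ => ?_
    rw [Algebra.smul_def]
    exact Ideal.mul_mem_right _ _ (hφ _ (congrFun hp i))
  · have hmul : ∀ (c : A) p, ψ (c • p) = φ c • ψ p := by
      intro c p
      ext i
      simp [hψ]
    suffices h : ∀ p ∈ fiberIdeal f u, ∀ q, ψ (q * p) = 0 from
      fun p hp => by simpa using h p hp 1
    intro p hp
    induction hp using Submodule.span_induction with
    | mem p hp =>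
      obtain ⟨i, rfl⟩ := hp
      intro q
      let c : A := hf.aevalEquiv (X i - C (u i))
      have hc : (c : MvPolynomial σ K) = f i - C (u i) := by
        simp [c, algebraMap_eq]
      have hφc : φ c = 0 := by
        change aeval u (hf.aevalEquiv.symm (hf.aevalEquiv _)) = 0
        simp
      have : q * (f i - C (u i)) = c • q := by
        rw [Algebra.smul_def, mul_comm]
        exact congrArg (· * q) hc.symm
      rw [this, hmul, hφc, zero_smul]
    | zero => simp
    | add p q _ _ hp hq => simp [mul_add, hp, hq]
    | smul r p _ hp => intro q; rw [smul_eq_mul, ← mul_assoc]; exact hp _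

/-- A fibre has at most as many points as the rank of the extension. -/
theorem finite_fiber {f : ι → MvPolynomial σ K} {u : ι → K} {r : ℕ}
    {ψ : MvPolynomial σ K →ₗ[K] (Fin r → K)} (hψ : Function.Surjective ψ)
    (hker : LinearMap.ker ψ = (fiberIdeal f u).restrictScalars K) :
    (fiber f u).Finite ∧ (fiber f u).ncard ≤ r := by
  have key : ∀ s : Finset (σ → K), (s : Set (σ → K)) ⊆ fiber f u → s.card ≤ r := by
    intro s hs
    obtain ⟨L, hL, -⟩ := exists_surjective_comp_eq_evalOn hψ hker hs
    simpa using LinearMap.finrank_le_finrank_of_surjective hL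
  have hfin : (fiber f u).Finite := by
    by_contra h
    obtain ⟨t, ht, htc⟩ := Set.Infinite.exists_subset_card_eq h (r + 1)
    have := key t ht
    omega
  refine ⟨hfin, ?_⟩
  rw [Set.ncard_eq_toFinset_card _ hfin]
  exact key _ (by simp)

/-- A fibre has the maximal number of points if and only if its ideal contains every polynomial
vanishing on it. -/
theorem ncard_fiber_eq_iff {f : ι → MvPolynomial σ K} {u : ι → K} {r : ℕ}
    {ψ : MvPolynomial σ K →ₗ[K] (Fin r → K)} (hψ : Function.Surjective ψ)
    (hker : LinearMap.ker ψ = (fiberIdeal f u).restrictScalars K) :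
    (fiber f u).ncard = r ↔
      ∀ p : MvPolynomial σ K, (∀ x ∈ fiber f u, eval x p = 0) → p ∈ fiberIdeal f u := by
  have hfin := (finite_fiber hψ hker).1
  have := hfin.fintype
  obtain ⟨L, hL, hLψ⟩ := exists_surjective_comp_eq_evalOn hψ hker subset_rfl
  have hinj : (fiber f u).ncard = r ↔ Function.Injective L := by
    rw [← Nat.card_coe_set_eq, Nat.card_eq_fintype_card]
    constructor
    · intro h
      exact (LinearMap.injective_iff_surjective_of_finrank_eq_finrank (by simp [h])).2 hL
    · intro h
      simpa using (LinearEquiv.ofBijective L ⟨h, hL⟩).finrank_eq.symm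
  rw [hinj, injective_iff_map_eq_zero, hψ.forall]
  refine forall_congr' fun p => ?_
  rw [hLψ, ← LinearMap.mem_ker (f := ψ), hker, Submodule.restrictScalars_mem]
  simp [_root_.funext_iff, evalOn_apply]

/-- If all polynomials vanishing on a finite fibre lie in the ideal of the fibre, then the Jacobian
does not vanish on the fibre. -/
theorem det_jacobian_ne_zero [Fintype σ] [DecidableEq σ] {f : σ → MvPolynomial σ K} {u x : σ → K}
    (hfin : (fiber f u).Finite) (hx : x ∈ fiber f u)
    (h : ∀ p : MvPolynomial σ K, (∀ y ∈ fiber f u, eval y p = 0) → p ∈ fiberIdeal f u) :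
    (Matrix.of fun i j => eval x (pderiv j (f i))).det ≠ 0 := by
  intro hdet
  obtain ⟨v, hv, hv0⟩ := Matrix.exists_mulVec_eq_zero_iff.2 hdet
  refine hv ?_
  ext j
  have hker : ∀ p ∈ fiberIdeal f u, ∑ j, eval x (pderiv j p) * v j = 0 := by
    intro p hp
    suffices H : eval x p = 0 ∧ ∑ j, eval x (pderiv j p) * v j = 0 from H.2
    induction hp using Submodule.span_induction with
    | mem p hp =>
      obtain ⟨i, rfl⟩ := hp
      refine ⟨by simp [hx i], ?_⟩
      simpa [Matrix.mulVec, dotProduct] using congrFun hv0 i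
    | zero => simp
    | add p q _ _ hp hq =>
      simp [add_mul, Finset.sum_add_distrib, hp, hq]
    | smul q p _ hp =>
      refine ⟨by simp [hp.1], ?_⟩
      have := congrArg (eval x q * ·) hp.2
      simpa [pderiv_mul, hp.1, Finset.mul_sum, mul_assoc] using this
  classical
  obtain ⟨p, hp, hp'⟩ := exists_eval_eq_one_and_eq_zero (hfin.toFinset.erase x) x (by simp)
  have hmem : (X j - C (x j)) * p ∈ fiberIdeal f u := by
    refine h _ fun y hy => ?_
    rcases eq_or_ne y x with rfl | hyx
    · simp
    · simp [hp' y (by simp [hyx, hy])]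
  simpa [pderiv_mul, hp, Pi.single_apply, apply_ite] using hker _ hmem

/-- If the Jacobian does not vanish on a fibre, then all polynomials vanishing on the fibre lie in
its ideal. -/
theorem mem_fiberIdeal_of_det_jacobian_ne_zero [Fintype σ] [DecidableEq σ] [IsAlgClosed K]
    {f : σ → MvPolynomial σ K} {u : σ → K}
    (h : ∀ x ∈ fiber f u, (Matrix.of fun i j => eval x (pderiv j (f i))).det ≠ 0)
    {p : MvPolynomial σ K} (hp : ∀ y ∈ fiber f u, eval y p = 0) : p ∈ fiberIdeal f u := by
  by_contra hpI
  have hne : (fiberIdeal f u).colon {p} ≠ ⊤ := by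
    intro htop
    have : (1 : MvPolynomial σ K) ∈ (fiberIdeal f u).colon {p} := htop ▸ Submodule.mem_top
    rw [Submodule.mem_colon_singleton, one_smul] at this
    exact hpI this
  obtain ⟨m, hm, hle⟩ := Ideal.exists_le_maximal _ hne
  obtain ⟨x, hmx⟩ := isMaximal_iff_eq_vanishingIdeal_singleton.1 hm
  have hm' : m = RingHom.ker (eval x) := by
    ext q
    rw [hmx, mem_vanishingIdeal_singleton_iff, RingHom.mem_ker, aeval_eq_eval]
  subst hm'
  have hx : x ∈ fiber f u := by
    refine fiberIdeal_le_ker_eval_iff.1 (le_trans (fun q hq => ?_) hle)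
    rw [Submodule.mem_colon_singleton, smul_eq_mul]
    exact Ideal.mul_mem_right _ _ hq
  set M : Matrix σ σ K := Matrix.of fun i j => eval x (pderiv j (f i)) with hM
  have hMu : IsUnit M.det := (h x hx).isUnit
  have hlin : ∀ i, ∑ j, C (M i j) * (X j - C (x j)) ∈
      fiberIdeal f u ⊔ RingHom.ker (eval x) ^ 2 := by
    intro i
    have h₁ := sub_C_eval_sub_sum_pderiv_mem_sq x (f i)
    rw [hx i] at h₁
    have := sub_mem (Ideal.mem_sup_left (T := RingHom.ker (eval x) ^ 2)
      (sub_C_mem_fiberIdeal f u i)) (Ideal.mem_sup_right h₁)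
    simpa [hM] using this
  have hX : ∀ k, X k - C (x k) ∈ fiberIdeal f u ⊔ RingHom.ker (eval x) ^ 2 := by
    intro k
    have : X k - C (x k) = ∑ i, C (M⁻¹ k i) * ∑ j, C (M i j) * (X j - C (x j)) := by
      simp only [Finset.mul_sum, ← mul_assoc, ← C_mul]
      rw [Finset.sum_comm]
      simp only [← Finset.sum_mul, ← map_sum, ← Matrix.mul_apply, Matrix.nonsing_inv_mul M hMu,
        Matrix.one_apply]
      simp
    rw [this]
    exact sum_mem fun i _ => Ideal.mul_mem_left _ _ (hlin i)
  have hsup : RingHom.ker (eval x) ≤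
      fiberIdeal f u ⊔ RingHom.ker (eval x) • RingHom.ker (eval x) := by
    rw [smul_eq_mul, ← pow_two]
    intro q hq
    have h₁ := sub_C_eval_sub_sum_pderiv_mem_sq x q
    rw [RingHom.mem_ker.1 hq, C_0, sub_zero] at h₁
    have h₂ := add_mem (Ideal.mem_sup_right (S := fiberIdeal f u) h₁)
      (sum_mem fun j (_ : j ∈ Finset.univ) => Ideal.mul_mem_left _ (C (eval x (pderiv j q))) (hX j))
    simpa using h₂
  obtain ⟨r, hr, hrle⟩ := Submodule.exists_sub_one_mem_and_smul_le_of_fg_of_le_sup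
    (IsNoetherian.noetherian _) le_rfl hsup
  have hrp : r ∈ (fiberIdeal f u).colon {p} := by
    rw [Submodule.mem_colon_singleton]
    exact hrle (Submodule.smul_mem_pointwise_smul _ _ _ (hp x hx))
  have hr1 := hle hrp
  rw [RingHom.mem_ker] at hr hr1
  simp [hr1] at hr

/-- Generators of a subalgebra over which a polynomial ring is finite are algebraically independent
if there are as many of them as variables. -/
theorem algebraicIndependent_of_finite {σ : Type*} [Finite σ] (f : σ → MvPolynomial σ K)
    [Module.Finite (Algebra.adjoin K (Set.range f)) (MvPolynomial σ K)] :
    AlgebraicIndependent K f :=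
  (Algebra.IsAlgebraic.isTranscendenceBasis_of_lift_le_trdeg_of_finite K f (by simp)).1

end Fiber

end MvPolynomial

open MvPolynomial in
theorem image_ramification_locus_eq_branch_locus {n : ℕ} (hn : 0 < n)
    (b : Fin n → ℕ) (hb : ∀ i, 0 < b i) (a : Fin n → ℕ)
    (f : Fin n → MvPolynomial (Fin n) ℂ)
    (hhom : ∀ i, IsWeightedHomogeneous b (f i) (a i))
    (A : Subalgebra ℂ (MvPolynomial (Fin n) ℂ))
    (hA : A = Algebra.adjoin ℂ (Set.range f))
    (hfin : Module.Finite A (MvPolynomial (Fin n) ℂ))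
    (hfree : Module.Free A (MvPolynomial (Fin n) ℂ))
    (r : ℕ) (hr : Module.finrank A (MvPolynomial (Fin n) ℂ) = r) :
    polyMap f '' {x | eval x (Jac f) = 0} = branchLocus f r := by
  subst hA
  have hjac : ∀ x, eval x (Jac f) = (Matrix.of fun i j => eval x (pderiv j (f i))).det := by
    intro x
    rw [Jac, RingHom.map_det]
    rfl
  have hfib : ∀ u, polyMap f ⁻¹' {u} = fiber f u := by
    intro u
    ext x
    simp [polyMap, fiber, funext_iff]
  ext u
  obtain ⟨ψ, hψ, hker⟩ :=
    exists_linearMap_ker_eq_fiberIdeal (algebraicIndependent_of_finite f) u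
  obtain ⟨hfinite, hle⟩ := finite_fiber hψ hker
  have hiff := ncard_fiber_eq_iff hψ hker
  rw [hr] at hle hiff
  simp only [branchLocus, hfib, Set.mem_ofPred_eq, hfinite, true_and, hle.lt_iff_ne, ne_eq, hiff,
    Set.mem_image, hjac]
  constructor
  · rintro ⟨x, hx, hxu⟩ h
    exact det_jacobian_ne_zero hfinite (fun i => congrFun hxu i) h hx
  · intro h
    by_contra! hne
    exact h fun p hp => mem_fiberIdeal_of_det_jacobian_ne_zero
      (fun x hx h0 => hne x h0 (funext hx)) hp
end

section
/- The restriction of f to a map ℂⁿ ∖ f⁻¹(U_branch) → ℂⁿ ∖ U_branch is a topological covering map (for the usual Euclidean topology), each of whose fibers has exactly r elements. -/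
/-- If the fibre of a continuous map `f` over `x` is finite, of maximal cardinality among the fibres
of `f`, and `f` is a local homeomorphism at each of its points, then `f` evenly covers `x`. -/
theorem isEvenlyCovered_of_encard_fiber_le {E X : Type*} [TopologicalSpace E] [TopologicalSpace X]
    [T2Space E] {f : E → X} {x : X} (fin : (f ⁻¹' {x}).Finite) (ne : (f ⁻¹' {x}).Nonempty)
    (hle : ∀ y, (f ⁻¹' {y}).encard ≤ (f ⁻¹' {x}).encard)
    (h : ∀ e ∈ f ⁻¹' {x}, ∃ φ : OpenPartialHomeomorph E X, e ∈ φ.source ∧ φ = f) :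
    IsEvenlyCovered f x (f ⁻¹' {x}) := by
  have : DiscreteTopology (f ⁻¹' {x}) :=
    (IsDiscrete.of_openPartialHomeomorph f subset_rfl h).1
  choose φ hφ using fun e : f ⁻¹' {x} ↦ h e e.2
  have ⟨V, hV, disj⟩ := fin.t2_separation
  let V' (e : f ⁻¹' {x}) := V e ∩ (φ e).source
  have hV' e : IsOpen (V' e) := (hV e).2.inter (φ e).open_source
  have disj' : Pairwise (Function.onFun Disjoint V') :=
    pairwise_disjoint_mono disj.subtype fun e ↦ Set.inter_subset_left
  have : Nonempty (f ⁻¹' {x}) := ne.to_subtype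
  have : Nonempty E := ⟨ne.some⟩
  have : Finite (f ⁻¹' {x}) := fin
  let U := ⋂ e : f ⁻¹' {x}, f '' V' e
  have hU : IsOpen U := isOpen_iInter_of_finite fun e ↦ by
    convert! ← (φ e).isOpen_image_of_subset_source (hV' _) Set.inter_subset_right
    exact (hφ e).2
  have hUV e : U ⊆ f '' V' e := Set.iInter_subset ..
  have exhaustive : f ⁻¹' U ⊆ ⋃ e, V' e := by
    intro z hz
    choose s hsV hs using fun e ↦ hUV e hz
    have hinj : Function.Injective s := fun e e' hee ↦ by
      by_contra hne
      exact (disj' hne).le_bot ⟨hsV e, hee ▸ hsV e'⟩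
    have hcard : (Set.range s).encard = (f ⁻¹' {x}).encard := by
      rw [← Set.image_univ, hinj.encard_image, Set.encard_univ, Set.encard]
    have hrange : Set.range s = f ⁻¹' {f z} :=
      (Set.finite_range s).eq_of_subset_of_encard_le
        (by rintro _ ⟨e, rfl⟩; exact hs e) (hcard ▸ hle (f z))
    obtain ⟨e, rfl⟩ : z ∈ Set.range s := hrange ▸ rfl
    exact Set.mem_iUnion_of_mem e (hsV e)
  refine .of_trivialization (t := hU.trivializationDiscrete _ _
    (fun e s hs ↦ ⟨fun h ↦ ?_, fun h ↦ ?_⟩) (fun e ↦ ?_)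
    (fun e ↦ .mono subset_rfl (hUV e) (Set.surjOn_image f _)) disj' exhaustive)
    (Set.mem_iInter.mpr fun e ↦ ⟨e, ⟨(hV e).1, (hφ e).1⟩, e.2⟩)
  · convert! ((φ e).isOpen_inter_preimage h).inter (hV e).2 using 1
    simp_rw [(hφ e).2, V']; ac_rfl
  · have : s ⊆ (φ e).target := hs.trans <| (hUV e).trans <| by
      rw [← (φ e).image_source_eq_target, (hφ e).2]; exact Set.image_mono Set.inter_subset_right
    rw [← (φ e).isOpen_symm_image_iff_of_subset_target this,
      (φ e).symm_image_eq_source_inter_preimage this, (hφ e).2, Set.inter_comm]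
    convert! h using 1
    refine Set.inter_eq_inter_iff_left.mpr ⟨fun e' h ↦ h.2.2, fun e' h ↦ ⟨?_ , h.2⟩⟩
    have ⟨e'', ⟨_, mem⟩, eq⟩ := Set.mem_iInter.mp (hs h.1) e
    rwa [← (φ e).injOn mem h.2 (by rwa [(hφ e).2])]
  · convert! ← (φ e).injOn.mono Set.inter_subset_right; exact (hφ e).2

namespace MvPolynomial

theorem exists_eval_eq_one_forall_eval_eq_zero {σ k : Type*} [Field k] (s : Finset (σ → k))
    (x : σ → k) (hx : x ∉ s) :
    ∃ p : MvPolynomial σ k, eval x p = 1 ∧ ∀ y ∈ s, eval y p = 0 := by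
  have h : ∀ y ∈ s, ∃ i, x i ≠ y i := fun y hy ↦
    Function.ne_iff.mp fun hxy ↦ hx (hxy ▸ hy)
  choose i hi using fun y : s ↦ h y y.2
  refine ⟨∏ y : s, C (x (i y) - y.1 (i y))⁻¹ * (X (i y) - C (y.1 (i y))), ?_, fun y hy ↦ ?_⟩
  · rw [map_prod]
    refine Finset.prod_eq_one fun y _ ↦ ?_
    simp [inv_mul_cancel₀ (sub_ne_zero.mpr (hi y))]
  · rw [map_prod]
    exact Finset.prod_eq_zero (Finset.mem_univ ⟨y, hy⟩) (by simp)

/-- Evaluation of polynomials at the points of a finite set is surjective. -/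
theorem exists_forall_eval_eq {σ k : Type*} [Field k] (s : Finset (σ → k)) (v : s → k) :
    ∃ p : MvPolynomial σ k, ∀ x : s, eval x.1 p = v x := by
  classical
  choose q hq1 hq0 using fun x : s ↦
    exists_eval_eq_one_forall_eval_eq_zero (s.erase x) x.1 (Finset.notMem_erase _ _)
  refine ⟨∑ x, C (v x) * q x, fun x ↦ ?_⟩
  rw [map_sum, Finset.sum_eq_single x]
  · simp [hq1]
  · intro y _ hyx
    simp [hq0 y x.1 (Finset.mem_erase.mpr ⟨fun h ↦ hyx (Subtype.ext h.symm), x.2⟩)]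
  · simp

theorem eval_eq_eval_of_mem_adjoin {σ ι k : Type*} [CommRing k] {f : ι → MvPolynomial σ k}
    {x y : σ → k} (hxy : ∀ i, eval x (f i) = eval y (f i)) {p : MvPolynomial σ k}
    (hp : p ∈ Algebra.adjoin k (Set.range f)) : eval x p = eval y p := by
  induction hp using Algebra.adjoin_induction with
  | mem p hp => obtain ⟨i, rfl⟩ := hp; exact hxy i
  | algebraMap c => simp [algebraMap_eq]
  | add p q _ _ hp hq => simp [hp, hq]
  | mul p q _ _ hp hq => simp [hp, hq]

theorem sub_C_eval_mem_span_of_mem_adjoin {σ ι k : Type*} [CommRing k] {f : ι → MvPolynomial σ k}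
    (x : σ → k) {p : MvPolynomial σ k} (hp : p ∈ Algebra.adjoin k (Set.range f)) :
    p - C (eval x p) ∈ Ideal.span (Set.range fun i ↦ f i - C (eval x (f i))) := by
  induction hp using Algebra.adjoin_induction with
  | mem p hp => obtain ⟨i, rfl⟩ := hp; exact Ideal.subset_span ⟨i, rfl⟩
  | algebraMap c => simp [algebraMap_eq]
  | add p q _ _ hp hq =>
    convert Ideal.add_mem _ hp hq using 1
    simp only [map_add]; ring
  | mul p q _ _ hp hq =>
    convert Ideal.add_mem _ (Ideal.mul_mem_left _ q hp)
      (Ideal.mul_mem_left _ (C (eval x p)) hq) using 1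
    simp only [map_mul]; ring

section Fiber

variable {σ κ ι k : Type*} [Field k] [Fintype ι] {f : κ → MvPolynomial σ k}
  (e : Module.Basis ι (Algebra.adjoin k (Set.range f)) (MvPolynomial σ k))

/-- The matrix, as a linear map, of the values of a basis of `k[X]` over `k[f]` at the points of a
finite set. -/
noncomputable def basisEval (s : Finset (σ → k)) : (ι → k) →ₗ[k] (s → k) :=
  Fintype.linearCombination k fun i (x : s) ↦ eval x.1 (e i)

theorem basisEval_repr {s : Finset (σ → k)} {x : σ → k}
    (hs : ∀ y ∈ s, ∀ i, eval y (f i) = eval x (f i)) (p : MvPolynomial σ k) :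
    basisEval e s (fun i ↦ eval x (e.repr p i).1) = fun y ↦ eval y.1 p := by
  funext y
  conv_rhs => rw [← e.sum_repr p, map_sum]
  simp only [basisEval, Fintype.linearCombination_apply, Finset.sum_apply, Pi.smul_apply,
    smul_eq_mul, Subalgebra.smul_def, map_mul]
  exact Finset.sum_congr rfl fun i _ ↦ by
    rw [eval_eq_eval_of_mem_adjoin (hs y y.2) (e.repr p i).2]

theorem basisEval_surjective {s : Finset (σ → k)} {x : σ → k}
    (hs : ∀ y ∈ s, ∀ i, eval y (f i) = eval x (f i)) :
    Function.Surjective (basisEval e s) := fun v ↦ by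
  obtain ⟨p, hp⟩ := exists_forall_eval_eq s v
  exact ⟨_, (basisEval_repr e hs p).trans (_root_.funext hp)⟩

include e in
theorem card_le_of_subset_fiber {s : Finset (σ → k)} {x : σ → k}
    (hs : ∀ y ∈ s, ∀ i, eval y (f i) = eval x (f i)) : s.card ≤ Fintype.card ι := by
  simpa using LinearMap.finrank_le_finrank_of_surjective (basisEval_surjective e hs)

include e in
/-- If the fibre of `f` through `x` has as many points as the rank of `k[X]` over `k[f]`, then the
ideal of the scheme-theoretic fibre is radical: it contains all polynomials that vanish on it. -/
theorem mem_span_of_forall_eval_eq_zero {s : Finset (σ → k)} {x : σ → k}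
    (hs : ∀ y ∈ s, ∀ i, eval y (f i) = eval x (f i)) (hcard : s.card = Fintype.card ι)
    {p : MvPolynomial σ k} (hp : ∀ y ∈ s, eval y p = 0) :
    p ∈ Ideal.span (Set.range fun i ↦ f i - C (eval x (f i))) := by
  have hinj : Function.Injective (basisEval e s) :=
    (LinearMap.injective_iff_surjective_of_finrank_eq_finrank (by simp [hcard])).mpr
      (basisEval_surjective e hs)
  have hzero : (fun i ↦ eval x (e.repr p i).1) = 0 := hinj <| by
    rw [basisEval_repr e hs p, map_zero]
    exact _root_.funext fun y ↦ hp y y.2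
  rw [← e.sum_repr p]
  refine Ideal.sum_mem _ fun i _ ↦ ?_
  rw [Subalgebra.smul_def, smul_eq_mul]
  refine Ideal.mul_mem_right _ _ ?_
  have := sub_C_eval_mem_span_of_mem_adjoin x (e.repr p i).2
  rwa [show eval x (e.repr p i).1 = 0 from congr_fun hzero i, C_0, sub_zero] at this

end Fiber

theorem contDiff_eval {σ : Type*} [Fintype σ] (p : MvPolynomial σ ℂ) {m : WithTop ℕ∞} :
    ContDiff ℂ m fun x : σ → ℂ ↦ eval x p :=
  AnalyticOnNhd.contDiff (AnalyticOnNhd.eval_mvPolynomial p)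

end MvPolynomial

section PolyMap

open MvPolynomial

variable {n : ℕ} (f : Fin n → MvPolynomial (Fin n) ℂ)

theorem contDiff_polyMap {m : WithTop ℕ∞} : ContDiff ℂ m (polyMap f) :=
  contDiff_pi.mpr fun i ↦ contDiff_eval (f i)

variable {f}

theorem mem_polyMap_fiber_iff {x y : Fin n → ℂ} :
    y ∈ polyMap f ⁻¹' {polyMap f x} ↔ ∀ i, eval y (f i) = eval x (f i) :=
  funext_iff

/-- If `p` does not vanish at `x` and annihilates the maximal ideal of `x` modulo the ideal of the
fibre through `x`, then the differential of the polynomial map at `x` is injective. -/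
theorem injective_fderiv_polyMap {x : Fin n → ℂ} {p : MvPolynomial (Fin n) ℂ} (hp : eval x p = 1)
    (h : ∀ j, p * (X j - C (x j)) ∈ Ideal.span (Set.range fun i ↦ f i - C (eval x (f i)))) :
    Function.Injective (fderiv ℂ (polyMap f) x) := by
  refine (injective_iff_map_eq_zero _).mpr fun v hv ↦ funext fun j ↦ ?_
  obtain ⟨c, hc⟩ := (Ideal.mem_span_range_iff_exists_fun).mp (h j)
  have hdiff (q : MvPolynomial (Fin n) ℂ) : DifferentiableAt ℂ (fun y ↦ eval y q) x :=
    (contDiff_eval q (m := 1)).differentiable one_ne_zero x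
  have hf (i : Fin n) : fderiv ℂ (fun y ↦ eval y (f i)) x v = 0 := by
    have := congr_fun hv i
    rwa [show polyMap f = fun y i ↦ eval y (f i) from rfl, fderiv_pi fun i ↦ hdiff (f i)] at this
  have hmul (q q' : MvPolynomial (Fin n) ℂ) : fderiv ℂ (fun y ↦ eval y (q * q')) x v =
      eval x q * fderiv ℂ (fun y ↦ eval y q') x v +
        eval x q' * fderiv ℂ (fun y ↦ eval y q) x v := by
    simp only [map_mul]
    rw [fderiv_fun_mul (hdiff q) (hdiff q')]
    rfl
  have hsub (q : MvPolynomial (Fin n) ℂ) (a : ℂ) :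
      fderiv ℂ (fun y ↦ eval y (q - C a)) x v = fderiv ℂ (fun y ↦ eval y q) x v := by
    simp only [map_sub, eval_C]
    rw [fderiv_sub_const]
  have hX : fderiv ℂ (fun y : Fin n → ℂ ↦ eval y (X j : MvPolynomial (Fin n) ℂ)) x v = v j := by
    simp only [eval_X]
    rw [(hasFDerivAt_apply j x).fderiv]
    rfl
  have hl := hmul p (X j - C (x j))
  have hr : fderiv ℂ (fun y ↦ eval y (∑ i, c i * (f i - C (eval x (f i))))) x v = 0 := by
    simp only [map_sum]
    rw [fderiv_fun_sum fun i _ ↦ hdiff _, sum_apply]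
    refine Finset.sum_eq_zero fun i _ ↦ ?_
    rw [hmul, hsub, hf]
    simp
  rw [hsub, hX, ← hc, hr, hp] at hl
  simpa using hl.symm

theorem exists_openPartialHomeomorph_polyMap {x : Fin n → ℂ}
    (h : Function.Injective (fderiv ℂ (polyMap f) x)) :
    ∃ φ : OpenPartialHomeomorph (Fin n → ℂ) (Fin n → ℂ), x ∈ φ.source ∧ φ = polyMap f := by
  let L : (Fin n → ℂ) ≃L[ℂ] (Fin n → ℂ) :=
    (LinearEquiv.ofInjectiveEndo (fderiv ℂ (polyMap f) x).toLinearMap h).toContinuousLinearEquiv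
  have hL : HasStrictFDerivAt (polyMap f) (L : (Fin n → ℂ) →L[ℂ] (Fin n → ℂ)) x := by
    rw [show (L : (Fin n → ℂ) →L[ℂ] (Fin n → ℂ)) = fderiv ℂ (polyMap f) x by ext; rfl]
    exact (contDiff_polyMap f (m := 1)).contDiffAt.hasStrictFDerivAt one_ne_zero
  exact ⟨hL.toOpenPartialHomeomorph, hL.mem_toOpenPartialHomeomorph_source, rfl⟩

variable {ι : Type*} [Fintype ι]
  (e : Module.Basis ι (Algebra.adjoin ℂ (Set.range f)) (MvPolynomial (Fin n) ℂ))

include e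

theorem encard_polyMap_fiber_le (y : Fin n → ℂ) :
    (polyMap f ⁻¹' {y}).encard ≤ Fintype.card ι := by
  by_contra! h
  obtain ⟨t, hts, ht⟩ := Set.exists_subset_encard_eq (Order.add_one_le_of_lt h)
  have htfin : t.Finite := Set.finite_of_encard_eq_coe (k := Fintype.card ι + 1) (by simpa using ht)
  lift t to Finset (Fin n → ℂ) using htfin
  rw [Set.encard_coe_eq_coe_finsetCard] at ht
  have ht' : t.card = Fintype.card ι + 1 := by exact_mod_cast ht
  obtain ⟨x, hx⟩ : t.Nonempty := Finset.card_pos.mp (by lia)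
  obtain rfl : polyMap f x = y := hts hx
  have := card_le_of_subset_fiber e fun z hz ↦ mem_polyMap_fiber_iff.mp (hts hz)
  lia

theorem injective_fderiv_polyMap_of_encard_fiber_eq {x : Fin n → ℂ}
    (hx : (polyMap f ⁻¹' {polyMap f x}).encard = Fintype.card ι) :
    Function.Injective (fderiv ℂ (polyMap f) x) := by
  classical
  obtain ⟨s, hs⟩ := (Set.finite_of_encard_eq_coe hx).exists_finset_coe
  rw [← hs, Set.encard_coe_eq_coe_finsetCard, Nat.cast_inj] at hx
  have hs' : ∀ y ∈ s, ∀ i, eval y (f i) = eval x (f i) := fun y hy ↦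
    mem_polyMap_fiber_iff.mp (hs ▸ hy)
  obtain ⟨p, hp1, hp0⟩ :=
    exists_eval_eq_one_forall_eval_eq_zero (s.erase x) x (Finset.notMem_erase _ _)
  refine injective_fderiv_polyMap hp1 fun j ↦
    mem_span_of_forall_eval_eq_zero e hs' hx fun y hy ↦ ?_
  by_cases hyx : y = x
  · simp [hyx]
  · simp [hp0 y (Finset.mem_erase.mpr ⟨hyx, hy⟩)]

end PolyMap

open MvPolynomial in
theorem restriction_is_covering_map {n : ℕ} (hn : 0 < n)
    (b : Fin n → ℕ) (hb : ∀ i, 0 < b i) (a : Fin n → ℕ)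
    (f : Fin n → MvPolynomial (Fin n) ℂ)
    (hhom : ∀ i, IsWeightedHomogeneous b (f i) (a i))
    (A : Subalgebra ℂ (MvPolynomial (Fin n) ℂ))
    (hA : A = Algebra.adjoin ℂ (Set.range f))
    (hfin : Module.Finite A (MvPolynomial (Fin n) ℂ))
    (hfree : Module.Free A (MvPolynomial (Fin n) ℂ))
    (r : ℕ) (hr : Module.finrank A (MvPolynomial (Fin n) ℂ) = r) :
    IsCoveringMap ((branchLocus f r)ᶜ.restrictPreimage (polyMap f)) ∧
      ∀ y : ((branchLocus f r)ᶜ : Set (Fin n → ℂ)),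
        Nat.card ((branchLocus f r)ᶜ.restrictPreimage (polyMap f) ⁻¹' {y}) = r := by
  subst hA
  let e := Module.finBasis (Algebra.adjoin ℂ (Set.range f)) (MvPolynomial (Fin n) ℂ)
  have hle (y : Fin n → ℂ) := encard_polyMap_fiber_le e y
  simp only [Fintype.card_fin, hr] at hle
  have hfinite (y : Fin n → ℂ) : (polyMap f ⁻¹' {y}).Finite :=
    Set.finite_of_encard_le_coe (hle y)
  have heq {y : Fin n → ℂ} (hy : y ∈ (branchLocus f r)ᶜ) : (polyMap f ⁻¹' {y}).encard = r := by
    refine (hle y).antisymm ?_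
    rw [← (hfinite y).cast_ncard_eq, Nat.cast_le]
    exact not_lt.mp fun h ↦ hy ⟨hfinite y, h⟩
  refine ⟨IsCoveringMapOn.isCoveringMap_restrictPreimage _ fun y hy ↦
    isEvenlyCovered_of_encard_fiber_le (hfinite y) ?_ (fun z ↦ (hle z).trans_eq (heq hy).symm) ?_,
    fun y ↦ ?_⟩
  · rw [← Set.encard_ne_zero, heq hy, Nat.cast_ne_zero]
    exact hr ▸ Module.finrank_pos.ne'
  · rintro x rfl
    exact exists_openPartialHomeomorph_polyMap <|
      injective_fderiv_polyMap_of_encard_fiber_eq e (by simpa [hr] using heq hy)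
  · have himage : Subtype.val '' ((branchLocus f r)ᶜ.restrictPreimage (polyMap f) ⁻¹' {y}) =
        polyMap f ⁻¹' {y.1} := by
      ext x
      constructor
      · rintro ⟨x, hx, rfl⟩
        exact congr_arg Subtype.val hx
      · intro hx
        exact ⟨⟨x, show polyMap f x ∈ _ from (show polyMap f x = y.1 from hx) ▸ y.2⟩,
          Subtype.ext hx, rfl⟩
    rw [Nat.card_coe_set_eq, ← Set.ncard_image_of_injective _ Subtype.val_injective, himage,
      Set.ncard, heq y.2, ENat.toNat_natCast]
end

section
/- Without any well-ramifiedness assumption, one always has the equality of ideals of A: (J·B) ∩ A = ((∏_{Q∈S} Q)·B) ∩ A, i.e., the contraction to A of the principal ideal of B generated by the Jacobian equals the contraction of the principal ideal of B generated by the product of one representative of each ramified irreducible. -/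
open MvPolynomial in
theorem pderiv_eq_zero_of_dvd {σ : Type} {p : MvPolynomial σ ℂ} {i : σ} (h : p ∣ pderiv i p) :
    pderiv i p = 0 := by
  by_contra h0
  obtain ⟨g, hg⟩ := h
  have hp : p ≠ 0 := by rintro rfl; simp at h0
  have hg0 : g ≠ 0 := by rintro rfl; simp at hg; exact h0 hg
  have hdeg := congrArg (degreeOf i) hg
  rw [degreeOf_mul_eq hp hg0] at hdeg
  have hpos : 0 < degreeOf i p := by
    rw [Nat.pos_iff_ne_zero]
    intro hz
    apply h0
    apply pderiv_eq_zero_of_notMem_vars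
    intro hi
    classical
    rw [degreeOf_def, Multiset.count_eq_zero] at hz
    exact hz (Multiset.mem_toFinset.mp (by rwa [vars_def] at hi))
  have hlt : degreeOf i (pderiv i p) < degreeOf i p := by
    rw [degreeOf_lt_iff hpos]
    intro m hm
    rw [mem_support_iff, coeff_pderiv] at hm
    have hm' : m + Finsupp.single i 1 ∈ p.support := by
      rw [mem_support_iff]; exact left_ne_zero_of_mul hm
    have := monomial_le_degreeOf i hm'
    simp at this
    omega
  omega

open MvPolynomial in
theorem exists_eq_C_of_forall_pderiv_eq_zero {σ : Type} {p : MvPolynomial σ ℂ}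
    (h : ∀ i, pderiv i p = 0) : ∃ c, p = C c := by
  refine ⟨coeff 0 p, ?_⟩
  classical
  ext m
  rw [coeff_C]
  split_ifs with hm
  · rw [hm]
  · obtain ⟨i, hi⟩ : ∃ i, m i ≠ 0 := by
      by_contra hc
      push Not at hc
      exact hm (by ext i; simp [hc i])
    have h1 := congrArg (coeff (m - Finsupp.single i 1)) (h i)
    rw [coeff_pderiv, tsub_add_cancel_of_le (by simpa [Nat.one_le_iff_ne_zero] using hi)] at h1
    rw [coeff_zero] at h1
    refine (mul_eq_zero.mp h1).resolve_right ?_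
    exact Nat.cast_add_one_ne_zero _

/-- A derivation sending a subring `A` and the generator of an ideal `(Q)` into `(Q)` maps
everything integral over `A` into `(Q)`, in characteristic zero and for `(Q)` prime. -/
theorem Derivation.dvd_of_isIntegral {B : Type*} [CommRing B] [Algebra ℂ B] (A : Subalgebra ℂ B)
    [Algebra.IsIntegral A B] {Q : B} (hQ : Prime Q) (D : Derivation ℂ B B)
    (hDA : ∀ x ∈ A, Q ∣ D x) (hDQ : Q ∣ D Q) (x : B) : Q ∣ D x := by
  classical
  by_contra hx
  have key : ∀ p : Polynomial A,
      Q ∣ D (Polynomial.aeval x p) - Polynomial.aeval x (Polynomial.derivative p) * D x := by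
    intro p
    induction p using Polynomial.induction_on' with
    | add p q hp hq =>
      have := dvd_add hp hq
      convert this using 1
      simp only [map_add]
      ring
    | monomial k c =>
      have h1 : D (Polynomial.aeval x (Polynomial.monomial k c)) -
          Polynomial.aeval x (Polynomial.derivative (Polynomial.monomial k c)) * D x =
          x ^ k * D (c : B) := by
        simp only [Polynomial.derivative_monomial, Polynomial.aeval_monomial, Derivation.leibniz,
          Derivation.leibniz_pow, smul_eq_mul, nsmul_eq_mul, map_mul, _root_.map_natCast]
        change (c : B) * _ + x ^ k * D (c : B) - _ = _
        rw [show algebraMap A B c = c from rfl]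
        ring
      rw [h1]
      exact (hDA _ c.2).mul_left _
  have hex : ∃ d : ℕ, ∃ p : Polynomial A, p.Monic ∧ p.natDegree = d ∧ Q ∣ Polynomial.aeval x p := by
    obtain ⟨p, hp, hp0⟩ := Algebra.IsIntegral.isIntegral (R := A) x
    exact ⟨_, p, hp, rfl, by rw [Polynomial.aeval_def, hp0]; exact dvd_zero _⟩
  obtain ⟨p, hp, hpd, hpQ⟩ := Nat.find_spec hex
  have hDp : Q ∣ D (Polynomial.aeval x p) := by
    obtain ⟨g, hg⟩ := hpQ
    rw [hg, Derivation.leibniz, smul_eq_mul, smul_eq_mul]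
    exact dvd_add (dvd_mul_right _ _) (hDQ.mul_left _)
  have h2 : Q ∣ Polynomial.aeval x (Polynomial.derivative p) := by
    have := (dvd_sub_right hDp).mp (key p)
    exact (hQ.dvd_or_dvd this).resolve_right hx
  have hd0 : p.natDegree ≠ 0 := by
    intro h0
    rw [hp.natDegree_eq_zero.mp h0, map_one] at hpQ
    exact hQ.not_isUnit (isUnit_of_dvd_one hpQ)
  set d := p.natDegree with hd
  have hdC : (d : ℂ) ≠ 0 := by exact_mod_cast hd0
  set q : Polynomial A := Polynomial.C (algebraMap ℂ A (d : ℂ)⁻¹) * Polynomial.derivative p with hq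
  have hcoeff : q.coeff (d - 1) = 1 := by
    rw [hq, Polynomial.coeff_C_mul, Polynomial.coeff_derivative,
      Nat.sub_add_cancel (Nat.one_le_iff_ne_zero.mpr hd0), hd, hp.coeff_natDegree, one_mul]
    have : ((p.natDegree - 1 : ℕ) : A) + 1 = algebraMap ℂ A (d : ℂ) := by
      rw [_root_.map_natCast (algebraMap ℂ A), ← Nat.cast_succ, Nat.succ_eq_add_one,
        Nat.sub_add_cancel (Nat.one_le_iff_ne_zero.mpr hd0)]
    rw [this, ← map_mul, inv_mul_cancel₀ hdC, map_one]
  have hqd : q.natDegree ≤ d - 1 :=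
    (Polynomial.natDegree_C_mul_le _ _).trans (Polynomial.natDegree_derivative_le p)
  have hqm : q.Monic := Polynomial.monic_of_natDegree_le_of_coeff_eq_one _ hqd hcoeff
  refine Nat.find_min hex (m := q.natDegree) (by omega) ⟨q, hqm, rfl, ?_⟩
  rw [hq, map_mul]
  exact h2.mul_left _

/-- If the adjugate of a singular square matrix `M` over a domain vanishes, the kernel of `M`
meets every hyperplane nontrivially. -/
theorem Matrix.exists_mulVec_eq_zero_of_adjugate_eq_zero {n C : Type*} [Fintype n] [DecidableEq n]
    [CommRing C] [IsDomain C] (M : Matrix n n C) (hdet : M.det = 0) (hadj : M.adjugate = 0)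
    (w : n → C) : ∃ v ≠ 0, M.mulVec v = 0 ∧ w ⬝ᵥ v = 0 := by
  obtain ⟨y, hy, hyM⟩ := Matrix.exists_vecMul_eq_zero_iff.mpr hdet
  obtain ⟨i, hi⟩ := Function.ne_iff.mp hy
  have hw : (M.updateRow i w).det = 0 := by
    have h1 : w = ∑ j, w j • (Pi.single j 1 : n → C) := by
      ext k; simp [Finset.sum_apply, Pi.single_apply]
    have h2 : ∀ j, (M.updateRow i (Pi.single j 1)).det = 0 := by
      intro j
      rw [← Matrix.adjugate_apply, hadj, Matrix.zero_apply]
    have h3 := map_sum (Matrix.detRowAlternating.toMultilinearMap.toLinearMap M i)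
      (fun j => w j • (Pi.single j 1 : n → C)) Finset.univ
    rw [← h1] at h3
    change (M.updateRow i w).det = ∑ j, (M.updateRow i (w j • Pi.single j 1)).det at h3
    rw [h3]
    exact Finset.sum_eq_zero fun j _ => by rw [Matrix.det_updateRow_smul, h2, mul_zero]
  have hN : (M.updateRow i (M i + w)).det = 0 := by
    rw [Matrix.det_updateRow_add, hw, add_zero]
    simpa using hdet
  obtain ⟨v, hv, hNv⟩ := Matrix.exists_mulVec_eq_zero_iff.mpr hN
  have hrow : ∀ k, M.mulVec v k + (if k = i then w ⬝ᵥ v else 0) = 0 := by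
    intro k
    have := congrFun hNv k
    simp only [Matrix.mulVec, Pi.zero_apply] at this ⊢
    split_ifs with hk
    · subst hk
      rwa [Matrix.updateRow_self, add_dotProduct] at this
    · rw [Matrix.updateRow_ne hk] at this
      simpa using this
  have hwv : w ⬝ᵥ v = 0 := by
    have h1 : y ⬝ᵥ M.mulVec v = 0 := by
      rw [Matrix.dotProduct_mulVec, hyM, zero_dotProduct]
    have h2 : y ⬝ᵥ M.mulVec v = - (y i * (w ⬝ᵥ v)) := by
      have h3 : M.mulVec v = - Pi.single i (w ⬝ᵥ v) := by
        ext k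
        have := hrow k
        rw [Pi.neg_apply, Pi.single_apply]
        exact eq_neg_of_add_eq_zero_left this
      rw [h3, dotProduct_neg, dotProduct_single]
    rw [h2, neg_eq_zero] at h1
    exact (mul_eq_zero.mp h1).resolve_left hi
  refine ⟨v, hv, ?_, hwv⟩
  ext k
  simpa [hwv] using hrow k

open MvPolynomial in
/-- The derivation `∑ j, v j • ∂ / ∂ X j`. -/
theorem mkDerivation_eq_sum_pderiv {n : ℕ} (v : Fin n → MvPolynomial (Fin n) ℂ)
    (g : MvPolynomial (Fin n) ℂ) : mkDerivation ℂ v g = ∑ j, pderiv j g * v j := by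
  classical
  induction g using MvPolynomial.induction_on with
  | C c => simp
  | add p q hp hq => simp [hp, hq, add_mul, Finset.sum_add_distrib]
  | mul_X p i hp =>
    simp only [Derivation.leibniz, hp, mkDerivation_X, smul_eq_mul, pderiv_X, add_mul,
      Finset.sum_add_distrib, Finset.mul_sum]
    congr 1
    · simp [Pi.single_apply]
    · exact Finset.sum_congr rfl fun _ _ => by ring

open MvPolynomial in
theorem Derivation.mvPolynomial_aeval {ι B : Type*} [Fintype ι] [CommRing B] [Algebra ℂ B]
    (D : Derivation ℂ B B) (f : ι → B) (p : MvPolynomial ι ℂ) :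
    D (aeval f p) = ∑ k, aeval f (pderiv k p) * D (f k) := by
  classical
  induction p using MvPolynomial.induction_on with
  | C c => simp
  | add p q hp hq => simp [hp, hq, add_mul, Finset.sum_add_distrib]
  | mul_X p i hp =>
    simp only [map_mul, Derivation.leibniz, hp, aeval_X, smul_eq_mul, pderiv_X, add_mul,
      Finset.sum_add_distrib, Finset.mul_sum, map_add]
    congr 1
    · simp [Pi.single_apply, apply_ite (aeval f)]
    · exact Finset.sum_congr rfl fun _ _ => by ring

theorem Derivation.dvd_of_mem_adjoin {B : Type*} [CommRing B] [Algebra ℂ B]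
    (D : Derivation ℂ B B) {s : Set B} {c : B} (h : ∀ x ∈ s, c ∣ D x) {x : B}
    (hx : x ∈ Algebra.adjoin ℂ s) : c ∣ D x := by
  induction hx using Algebra.adjoin_induction with
  | mem x hx => exact h x hx
  | algebraMap r => simp
  | add x y _ _ hx hy => rw [map_add]; exact dvd_add hx hy
  | mul x y _ _ hx hy =>
    rw [Derivation.leibniz, smul_eq_mul, smul_eq_mul]
    exact dvd_add (hy.mul_left _) (hx.mul_left _)

open MvPolynomial in
/-- The derivation `J • ∂ / ∂ f k` of the polynomial ring. -/
noncomputable def cofactorDerivation {n : ℕ} (f : Fin n → MvPolynomial (Fin n) ℂ) (k : Fin n) :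
    Derivation ℂ (MvPolynomial (Fin n) ℂ) (MvPolynomial (Fin n) ℂ) :=
  mkDerivation ℂ fun j => (Matrix.of fun i j : Fin n => pderiv j (f i)).adjugate j k

open MvPolynomial in
theorem cofactorDerivation_apply {n : ℕ} (f : Fin n → MvPolynomial (Fin n) ℂ) (k i : Fin n) :
    cofactorDerivation f k (f i) = if i = k then Jac f else 0 := by
  rw [cofactorDerivation, mkDerivation_eq_sum_pderiv]
  have := congrFun (congrFun
    (Matrix.mul_adjugate (Matrix.of fun i j : Fin n => pderiv j (f i))) i) k
  rw [Matrix.mul_apply, Matrix.smul_apply, Matrix.one_apply] at this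
  simp only [Matrix.of_apply, smul_eq_mul, mul_ite, mul_one, mul_zero] at this
  exact this

open MvPolynomial in
theorem cofactorDerivation_aeval {n : ℕ} (f : Fin n → MvPolynomial (Fin n) ℂ) (k : Fin n)
    (p : MvPolynomial (Fin n) ℂ) :
    cofactorDerivation f k (aeval f p) = aeval f (pderiv k p) * Jac f := by
  rw [Derivation.mvPolynomial_aeval]
  simp [cofactorDerivation_apply]

open MvPolynomial in
theorem dvd_jac_of_ramified {n : ℕ} {f : Fin n → MvPolynomial (Fin n) ℂ}
    (hf : AlgebraicIndependent ℂ f) {Q : MvPolynomial (Fin n) ℂ} (hQ : Prime Q)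
    {e : ℕ} (he : 1 < e) (hR : RamIdx (Algebra.adjoin ℂ (Set.range f)) Q e) : Q ∣ Jac f := by
  obtain ⟨P, hP, hspan, hPe, -⟩ := hR
  by_contra hJ
  obtain ⟨p, rfl⟩ := hf.aevalEquiv.surjective P
  have hmem : ∀ g : MvPolynomial (Fin n) ℂ, Q ∣ aeval f g → p ∣ g := by
    intro g hg
    have h1 : hf.aevalEquiv g ∈ (Ideal.span {Q}).comap (algebraMap
        (Algebra.adjoin ℂ (Set.range f)) (MvPolynomial (Fin n) ℂ)) := by
      rw [Ideal.mem_comap, hf.algebraMap_aevalEquiv, Ideal.mem_span_singleton]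
      exact hg
    rw [hspan, Ideal.mem_span_singleton] at h1
    exact (map_dvd_iff hf.aevalEquiv).mp h1
  have hcoe : ((hf.aevalEquiv p : Algebra.adjoin ℂ (Set.range f)) : MvPolynomial (Fin n) ℂ) =
      aeval f p := hf.algebraMap_aevalEquiv p
  rw [hcoe] at hPe
  have hzero : ∀ k, pderiv k p = 0 := by
    intro k
    apply pderiv_eq_zero_of_dvd
    apply hmem
    have h1 : Q ∣ aeval f (pderiv k p) * Jac f := by
      rw [← cofactorDerivation_aeval]
      obtain ⟨g, hg⟩ := (pow_dvd_pow Q he).trans hPe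
      rw [hg, pow_succ, pow_one, mul_assoc, Derivation.leibniz, Derivation.leibniz]
      simp only [smul_eq_mul]
      exact dvd_add (dvd_mul_right _ _) (by simp [mul_assoc])
    exact (hQ.dvd_or_dvd h1).resolve_right hJ
  obtain ⟨c, rfl⟩ := exists_eq_C_of_forall_pderiv_eq_zero hzero
  by_cases hc : c = 0
  · exact hP.ne_zero (by simp [hc])
  · exact hP.not_isUnit (((isUnit_iff_ne_zero.mpr hc).map C).map hf.aevalEquiv)

open MvPolynomial in
theorem exists_not_dvd_adjugate {n : ℕ} {f : Fin n → MvPolynomial (Fin n) ℂ}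
    [Algebra.IsIntegral (Algebra.adjoin ℂ (Set.range f)) (MvPolynomial (Fin n) ℂ)]
    {Q : MvPolynomial (Fin n) ℂ} (hQ : Prime Q) (hJ : Q ∣ Jac f) :
    ∃ j k, ¬ Q ∣ (Matrix.of fun i j : Fin n => pderiv j (f i)).adjugate j k := by
  by_contra! hall
  set M := Matrix.of fun i j : Fin n => pderiv j (f i) with hM
  have : (Ideal.span {Q}).IsPrime := (Ideal.span_singleton_prime hQ.ne_zero).mpr hQ
  let π := Ideal.Quotient.mk (Ideal.span {Q})
  have hπ : ∀ x, π x = 0 ↔ Q ∣ x := fun x => by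
    rw [Ideal.Quotient.eq_zero_iff_mem, Ideal.mem_span_singleton]
  obtain ⟨v, hv, hMv, hwv⟩ := Matrix.exists_mulVec_eq_zero_of_adjugate_eq_zero (π.mapMatrix M)
    (by rw [← RingHom.map_det, hπ]; exact hJ)
    (by
      rw [← RingHom.map_adjugate]
      ext j k
      exact (hπ _).mpr (hall j k))
    (fun j => π (pderiv j Q))
  choose u hu using fun j => Ideal.Quotient.mk_surjective (v j)
  have hD : ∀ g, Q ∣ mkDerivation ℂ u g ↔ (fun j => π (pderiv j g)) ⬝ᵥ v = 0 := by
    intro g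
    rw [mkDerivation_eq_sum_pderiv, ← hπ, map_sum, dotProduct]
    simp only [map_mul]
    have : ∀ j, π (u j) = v j := hu
    simp only [this]
  apply hv
  ext j
  have h1 := Derivation.dvd_of_isIntegral (Algebra.adjoin ℂ (Set.range f)) hQ (mkDerivation ℂ u)
    (fun x hx => Derivation.dvd_of_mem_adjoin _ (by
      rintro _ ⟨i, rfl⟩
      rw [hD]
      exact congrFun hMv i) hx) ((hD Q).mpr hwv) (X j)
  rw [mkDerivation_X, ← hπ] at h1
  rw [← hu j]
  exact h1

open MvPolynomial in
theorem not_pow_dvd_jac {n : ℕ} {f : Fin n → MvPolynomial (Fin n) ℂ}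
    [Algebra.IsIntegral (Algebra.adjoin ℂ (Set.range f)) (MvPolynomial (Fin n) ℂ)]
    {Q : MvPolynomial (Fin n) ℂ} (hQ : Prime Q) {e : ℕ} (he : e ≠ 0)
    (hR : RamIdx (Algebra.adjoin ℂ (Set.range f)) Q e) : ¬ Q ^ e ∣ Jac f := by
  intro hJe
  obtain ⟨P, -, -, ⟨u, hu⟩, hPe⟩ := hR
  have hJ : Q ∣ Jac f := (dvd_pow_self Q he).trans hJe
  obtain ⟨j, k, hjk⟩ := exists_not_dvd_adjugate hQ hJ
  set D := cofactorDerivation f k with hDdef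
  have hDA : ∀ x ∈ Algebra.adjoin ℂ (Set.range f), Jac f ∣ D x := fun x hx =>
    Derivation.dvd_of_mem_adjoin _ (by
      rintro _ ⟨i, rfl⟩
      rw [hDdef, cofactorDerivation_apply]
      split_ifs <;> simp) hx
  have hDQ : ¬ Q ∣ D Q := by
    intro hDQ
    have := Derivation.dvd_of_isIntegral _ hQ D (fun x hx => hJ.trans (hDA x hx)) hDQ (X j)
    rw [hDdef, cofactorDerivation, mkDerivation_X] at this
    exact hjk this
  have hQu : ¬ Q ∣ u := by
    rintro ⟨w, rfl⟩
    exact hPe ⟨w, by rw [hu]; ring⟩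
  have hDP : Q ^ e ∣ D P := hJe.trans (hDA P P.2)
  obtain ⟨m, rfl⟩ := Nat.exists_eq_succ_of_ne_zero he
  rw [hu, Derivation.leibniz, Derivation.leibniz_pow] at hDP
  simp only [smul_eq_mul, nsmul_eq_mul, Nat.succ_eq_add_one, Nat.add_sub_cancel] at hDP
  have h1 : Q ^ (m + 1) ∣ u * (((m + 1 : ℕ) : MvPolynomial (Fin n) ℂ) * (Q ^ m * D Q)) :=
    (dvd_add_right (dvd_mul_right _ _)).mp hDP
  have h2 : Q ∣ u * (((m + 1 : ℕ) : MvPolynomial (Fin n) ℂ) * D Q) := by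
    rw [pow_succ] at h1
    refine (mul_dvd_mul_iff_left (pow_ne_zero m hQ.ne_zero)).mp (h1.trans (dvd_of_eq ?_))
    ring
  rcases hQ.dvd_or_dvd h2 with h | h
  · exact hQu h
  rcases hQ.dvd_or_dvd h with h | h
  · refine hQ.not_isUnit (isUnit_of_dvd_unit h ?_)
    have : ((m + 1 : ℕ) : MvPolynomial (Fin n) ℂ) = C ((m + 1 : ℕ) : ℂ) := by simp
    rw [this]
    exact (isUnit_iff_ne_zero.mpr (Nat.cast_ne_zero.mpr m.succ_ne_zero)).map C
  · exact hDQ h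

open MvPolynomial in
theorem exists_ramIdx_s7 {σ : Type} (A : Subalgebra ℂ (MvPolynomial σ ℂ))
    [UniqueFactorizationMonoid A] [Algebra.IsIntegral A (MvPolynomial σ ℂ)]
    {Q : MvPolynomial σ ℂ} (hQ : Prime Q) : ∃ e ≠ 0, RamIdx A Q e := by
  have hQp : (Ideal.span {Q}).IsPrime := (Ideal.span_singleton_prime hQ.ne_zero).mpr hQ
  have hne : (Ideal.span {Q}).comap (algebraMap A (MvPolynomial σ ℂ)) ≠ ⊥ :=
    Ideal.comap_ne_bot_of_integral_mem hQ.ne_zero (Ideal.mem_span_singleton_self Q)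
      (Algebra.IsIntegral.isIntegral Q)
  obtain ⟨P, hPmem, hP⟩ := Ideal.IsPrime.exists_mem_prime_of_ne_bot inferInstance hne
  have hPspan : (Ideal.span {P}).IsPrime := (Ideal.span_singleton_prime hP.ne_zero).mpr hP
  have hlie : (Ideal.span {Q}).LiesOver
      ((Ideal.span {Q}).comap (algebraMap A (MvPolynomial σ ℂ))) := ⟨rfl⟩
  obtain ⟨q, hqQ, hq, hqP⟩ := Ideal.exists_ideal_le_liesOver_of_le (Ideal.span {Q})
    (p := Ideal.span {P}) (q := (Ideal.span {Q}).comap (algebraMap A (MvPolynomial σ ℂ)))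
    ((Ideal.span_singleton_le_iff_mem _).mpr hPmem)
  have hqspan : q = Ideal.span {Q} := by
    have hq0 : q ≠ ⊥ := by
      rintro rfl
      have h1 : P ∈ Ideal.span {P} := Ideal.mem_span_singleton_self P
      rw [hqP.over] at h1
      simp only [Ideal.under, Ideal.mem_comap, Ideal.mem_bot] at h1
      exact hP.ne_zero (by simpa using h1)
    obtain ⟨Q', hQ'q, hQ'⟩ := hq.exists_mem_prime_of_ne_bot hq0
    have hdvd : Q ∣ Q' := Ideal.mem_span_singleton.mp (hqQ hQ'q)
    refine le_antisymm hqQ ?_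
    rw [Ideal.span_singleton_le_iff_mem]
    exact Ideal.mem_of_dvd _ (hQ.associated_of_dvd hQ' hdvd).symm.dvd hQ'q
  have hcomap : (Ideal.span {Q}).comap (algebraMap A (MvPolynomial σ ℂ)) = Ideal.span {P} := by
    rw [hqP.over, hqspan]
  have hP0 : (P : MvPolynomial σ ℂ) ≠ 0 := by simpa using hP.ne_zero
  have hfm : FiniteMultiplicity Q (P : MvPolynomial σ ℂ) :=
    FiniteMultiplicity.of_prime_left hQ hP0
  have hQP : Q ∣ (P : MvPolynomial σ ℂ) := Ideal.mem_span_singleton.mp hPmem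
  refine ⟨multiplicity Q (P : MvPolynomial σ ℂ), ?_, P, hP.irreducible, hcomap,
    pow_multiplicity_dvd _ _, hfm.not_pow_dvd_of_multiplicity_lt (Nat.lt_succ_self _)⟩
  rw [multiplicity_ne_zero]
  exact hQP

theorem RamIdx.pow_dvd {σ : Type} {A : Subalgebra ℂ (MvPolynomial σ ℂ)} {Q : MvPolynomial σ ℂ}
    {e : ℕ} (hR : RamIdx A Q e) {h : A} (hQ : Q ∣ (h : MvPolynomial σ ℂ)) :
    Q ^ e ∣ (h : MvPolynomial σ ℂ) := by
  obtain ⟨P, -, hspan, hPe, -⟩ := hR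
  have h1 : h ∈ (Ideal.span {Q}).comap (algebraMap A (MvPolynomial σ ℂ)) :=
    Ideal.mem_span_singleton.mpr hQ
  rw [hspan, Ideal.mem_span_singleton] at h1
  exact hPe.trans (map_dvd A.val h1)

open MvPolynomial in
theorem algebraicIndependent_of_isIntegral {n : ℕ} (f : Fin n → MvPolynomial (Fin n) ℂ)
    [Algebra.IsIntegral (Algebra.adjoin ℂ (Set.range f)) (MvPolynomial (Fin n) ℂ)] :
    AlgebraicIndependent ℂ f := by
  have : Algebra.IsAlgebraic (Algebra.adjoin ℂ (Set.range f)) (MvPolynomial (Fin n) ℂ) :=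
    inferInstance
  exact (Algebra.IsAlgebraic.isTranscendenceBasis_of_le_trdeg_of_finite ℂ f
    (by simp [MvPolynomial.trdeg_of_isDomain])).1

open MvPolynomial in
theorem contraction_jacobian_eq_contraction_reduced_product {n : ℕ} (hn : 0 < n)
    (b : Fin n → ℕ) (hb : ∀ i, 0 < b i) (a : Fin n → ℕ)
    (f : Fin n → MvPolynomial (Fin n) ℂ)
    (hhom : ∀ i, IsWeightedHomogeneous b (f i) (a i))
    (A : Subalgebra ℂ (MvPolynomial (Fin n) ℂ))
    (hA : A = Algebra.adjoin ℂ (Set.range f))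
    (hfin : Module.Finite A (MvPolynomial (Fin n) ℂ))
    (S : Finset (MvPolynomial (Fin n) ℂ)) (eIdx : MvPolynomial (Fin n) ℂ → ℕ)
    (hS : RamReps A S eIdx) :
    (Ideal.span {Jac f}).comap (algebraMap A (MvPolynomial (Fin n) ℂ)) =
      (Ideal.span {∏ Q ∈ S, Q}).comap (algebraMap A (MvPolynomial (Fin n) ℂ)) := by
  subst hA
  have hint : Algebra.IsIntegral (Algebra.adjoin ℂ (Set.range f)) (MvPolynomial (Fin n) ℂ) :=
    inferInstance
  have hf := algebraicIndependent_of_isIntegral f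
  have hufd : UniqueFactorizationMonoid (Algebra.adjoin ℂ (Set.range f)) :=
    hf.aevalEquiv.toMulEquiv.uniqueFactorizationMonoid inferInstance
  obtain ⟨hS1, hS2, hS3⟩ := hS
  have hJ0 : Jac f ≠ 0 := by
    intro h0
    obtain ⟨e, he, hR⟩ := exists_ramIdx_s7 (Algebra.adjoin ℂ (Set.range f))
      (MvPolynomial.X_prime (R := ℂ) (i := (⟨0, hn⟩ : Fin n)))
    exact not_pow_dvd_jac MvPolynomial.X_prime he hR (h0 ▸ dvd_zero _)
  ext h
  rw [Ideal.mem_comap, Ideal.mem_comap, Ideal.mem_span_singleton, Ideal.mem_span_singleton]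
  constructor
  · intro hJh
    refine Finset.prod_dvd_of_isRelPrime (fun Q hQ Q' hQ' hne => ?_) fun Q hQ => ?_
    · exact ((hS1 Q hQ).1.isRelPrime_iff_not_dvd).mpr fun hd =>
        hS2 Q hQ Q' hQ' hne ((hS1 Q hQ).1.associated_of_dvd (hS1 Q' hQ').1 hd)
    · obtain ⟨hirr, hR, he⟩ := hS1 Q hQ
      exact (dvd_jac_of_ramified hf hirr.prime he hR).trans hJh
  · intro hSh
    rw [UniqueFactorizationMonoid.dvd_iff_emultiplicity_le hJ0]
    intro Q hQ
    rw [emultiplicity_le_emultiplicity_iff]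
    intro m hm
    rcases Nat.eq_zero_or_pos m with rfl | hm0
    · simp
    obtain ⟨e, he, hR⟩ := exists_ramIdx_s7 (Algebra.adjoin ℂ (Set.range f)) hQ
    have hme : m < e := by
      by_contra! hle
      exact not_pow_dvd_jac hQ he hR ((pow_dvd_pow Q hle).trans hm)
    obtain ⟨Q', ⟨hQ'S, hass⟩, -⟩ := hS3 Q ⟨hQ.irreducible, e, hR, by omega⟩
    have hQS : Q' ∣ ∏ Q ∈ S, Q := Finset.dvd_prod_of_mem (fun Q => Q) hQ'S
    have hQh : Q ∣ (h : MvPolynomial (Fin n) ℂ) := (hass.dvd.trans hQS).trans hSh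
    exact (pow_dvd_pow Q hme.le).trans (hR.pow_dvd hQh)
end

section
/- D ∈ A if and only if for every irreducible element P ∈ A, regarded as an element of B, either P is squarefree in B, or every irreducible factor of P in B occurs with multiplicity at least 2. -/
attribute [local instance] FractionRing.liftAlgebra in
theorem Algebra.intNorm_algebraMap_eq_pow {A B : Type*} [CommRing A] [IsDomain A]
    [IsIntegrallyClosed A] [CommRing B] [IsDomain B] [IsIntegrallyClosed B] [Algebra A B]
    [Module.Finite A B] [Module.IsTorsionFree A B] (x : A) :
    Algebra.intNorm A B (algebraMap A B x) =
      x ^ Module.finrank (FractionRing A) (FractionRing B) := by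
  apply FaithfulSMul.algebraMap_injective A (FractionRing A)
  rw [Algebra.algebraMap_intNorm_fractionRing, ← IsScalarTower.algebraMap_apply,
    IsScalarTower.algebraMap_apply A (FractionRing A) (FractionRing B), Algebra.norm_algebraMap,
    map_pow]

/-- In a finite extension of integrally closed domains, an irreducible factor of a prime element
of the base lies over the ideal generated by that prime. -/
theorem Prime.comap_span_singleton_eq_of_dvd {A B : Type*} [CommRing A] [IsDomain A]
    [IsIntegrallyClosed A] [CommRing B] [IsDomain B] [IsIntegrallyClosed B] [Algebra A B]
    [Module.Finite A B] [Module.IsTorsionFree A B] {P : A} (hP : Prime P) {Q : B}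
    (hQ : Irreducible Q) (hdvd : Q ∣ algebraMap A B P) :
    (Ideal.span {Q}).comap (algebraMap A B) = Ideal.span {P} := by
  have hPN : P ∣ Algebra.intNorm A B Q := by
    have h := map_dvd (Algebra.intNorm A B) hdvd
    rw [Algebra.intNorm_algebraMap_eq_pow] at h
    obtain ⟨k, -, hk⟩ := (dvd_prime_pow hP _).1 h
    rcases Nat.eq_zero_or_pos k with rfl | hpos
    · rw [pow_zero, associated_one_iff_isUnit] at hk
      exact absurd (isUnit_of_dvd_unit (Algebra.dvd_algebraMap_intNorm_self A B Q)
        (hk.map (algebraMap A B))) hQ.not_isUnit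
    · exact (dvd_pow_self P hpos.ne').trans hk.symm.dvd
  ext x
  rw [Ideal.mem_comap, Ideal.mem_span_singleton, Ideal.mem_span_singleton]
  refine ⟨fun h ↦ ?_, fun h ↦ hdvd.trans (map_dvd (algebraMap A B) h)⟩
  have h := map_dvd (Algebra.intNorm A B) h
  rw [Algebra.intNorm_algebraMap_eq_pow] at h
  exact hP.dvd_of_dvd_pow (hPN.trans h)

/-- If a polynomial ring over a field is finite over the subalgebra generated by as many elements
as there are variables, then this subalgebra is a unique factorization domain. -/
theorem MvPolynomial.uniqueFactorizationMonoid_adjoin_range {K ι : Type} [Field K] [Finite ι]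
    (f : ι → MvPolynomial ι K)
    [Module.Finite (Algebra.adjoin K (Set.range f)) (MvPolynomial ι K)] :
    UniqueFactorizationMonoid (Algebra.adjoin K (Set.range f)) := by
  have halg : Algebra.IsAlgebraic (Algebra.adjoin K (Set.range f)) (MvPolynomial ι K) :=
    inferInstance
  have hf : IsTranscendenceBasis K f :=
    Algebra.IsAlgebraic.isTranscendenceBasis_of_le_trdeg_of_finite K f
      (by rw [MvPolynomial.trdeg_of_isDomain, Cardinal.lift_id])
  exact hf.1.aevalEquiv.toMulEquiv.uniqueFactorizationMonoid inferInstance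

theorem MultIs.of_associated {σ : Type} {Q P P' : MvPolynomial σ ℂ} {e : ℕ} (h : MultIs Q P e)
    (hP : Associated P P') : MultIs Q P' e :=
  ⟨h.1.trans hP.dvd, fun h' ↦ h.2 (h'.trans hP.symm.dvd)⟩

/-- The ramification index can be computed with any generator of the contracted ideal. -/
theorem RamIdx.multIs {σ : Type} {A : Subalgebra ℂ (MvPolynomial σ ℂ)}
    {Q : MvPolynomial σ ℂ} {e : ℕ} (h : RamIdx A Q e) {P : A}
    (hP : (Ideal.span {Q}).comap (algebraMap A (MvPolynomial σ ℂ)) = Ideal.span {P}) :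
    MultIs Q (P : MvPolynomial σ ℂ) e := by
  obtain ⟨P', -, hP', hmult⟩ := h
  have hass : Associated P' P := Ideal.span_singleton_eq_span_singleton.1 (hP'.symm.trans hP)
  exact hmult.of_associated (hass.map A.val)

theorem isRamified_of_sq_dvd {σ : Type} {A : Subalgebra ℂ (MvPolynomial σ ℂ)} {P : A}
    (hP : Irreducible P) {Q : MvPolynomial σ ℂ} (hQ : Irreducible Q)
    (hcomap : (Ideal.span {Q}).comap (algebraMap A (MvPolynomial σ ℂ)) = Ideal.span {P})
    (hsq : Q ^ 2 ∣ (P : MvPolynomial σ ℂ)) : IsRamified A Q := by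
  have hP0 : (P : MvPolynomial σ ℂ) ≠ 0 := by simpa using hP.ne_zero
  obtain ⟨e, c, hc, hPe⟩ :=
    WfDvdMonoid.max_power_factor' hP0 hQ.not_isUnit
  have hmult : MultIs Q (P : MvPolynomial σ ℂ) e := by
    refine ⟨⟨c, hPe⟩, fun h ↦ hc ?_⟩
    rw [hPe, pow_succ] at h
    exact (mul_dvd_mul_iff_left (pow_ne_zero e hQ.ne_zero)).1 h
  refine ⟨hQ, e, ⟨P, hP, hcomap, hmult⟩, ?_⟩
  by_contra hle
  exact hmult.2 ((pow_dvd_pow Q (by omega)).trans hsq)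

theorem MvPolynomial.mem_subalgebra_of_isUnit_mul_mem {σ K : Type*} [Field K]
    {A : Subalgebra K (MvPolynomial σ K)} {p c : MvPolynomial σ K} (hc : IsUnit c)
    (h : p * c ∈ A) : p ∈ A := by
  obtain ⟨r, hr, rfl⟩ := MvPolynomial.isUnit_iff_eq_C_of_isReduced.1 hc
  have := A.smul_mem h r⁻¹
  rwa [mul_comm, ← MvPolynomial.smul_eq_C_mul, smul_smul, inv_mul_cancel₀ hr.ne_zero,
    one_smul] at this

open MvPolynomial in
theorem discriminant_mem_iff_squarefree_or_nonreduced {n : ℕ} (hn : 0 < n)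
    (b : Fin n → ℕ) (hb : ∀ i, 0 < b i) (a : Fin n → ℕ)
    (f : Fin n → MvPolynomial (Fin n) ℂ)
    (hhom : ∀ i, IsWeightedHomogeneous b (f i) (a i))
    (A : Subalgebra ℂ (MvPolynomial (Fin n) ℂ))
    (hA : A = Algebra.adjoin ℂ (Set.range f))
    (hfin : Module.Finite A (MvPolynomial (Fin n) ℂ))
    (S : Finset (MvPolynomial (Fin n) ℂ)) (eIdx : MvPolynomial (Fin n) ℂ → ℕ)
    (hS : RamReps A S eIdx) :
    (∏ Q ∈ S, Q ^ eIdx Q) ∈ A ↔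
      ∀ P : A, Irreducible P →
        Squarefree (P : MvPolynomial (Fin n) ℂ) ∨
        ∀ Q : MvPolynomial (Fin n) ℂ, Irreducible Q → Q ∣ (P : MvPolynomial (Fin n) ℂ) →
          Q ^ 2 ∣ (P : MvPolynomial (Fin n) ℂ) := by
  classical
  subst hA
  set A := Algebra.adjoin ℂ (Set.range f)
  have hufm : UniqueFactorizationMonoid A :=
    MvPolynomial.uniqueFactorizationMonoid_adjoin_range f
  have hcomap : ∀ P : A, Irreducible P → ∀ Q : MvPolynomial (Fin n) ℂ, Irreducible Q →
      Q ∣ (P : MvPolynomial (Fin n) ℂ) →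
      (Ideal.span {Q}).comap (algebraMap A (MvPolynomial (Fin n) ℂ)) = Ideal.span {P} :=
    fun P hP Q hQ h ↦ hP.prime.comap_span_singleton_eq_of_dvd hQ h
  obtain ⟨hS₁, hS₂, hS₃⟩ := hS
  have hdvdD : ∀ Q, IsRamified A Q → Q ∣ ∏ Q ∈ S, Q ^ eIdx Q := by
    intro Q hQ
    obtain ⟨Q', ⟨hQ'S, hass⟩, -⟩ := hS₃ Q hQ
    have he := (hS₁ Q' hQ'S).2.2
    exact hass.dvd.trans ((dvd_pow_self Q' (by omega)).trans
      (Finset.dvd_prod_of_mem (fun Q ↦ Q ^ eIdx Q) hQ'S))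
  constructor
  · intro hD P hP
    refine or_iff_not_imp_left.2 fun hsq Q hQ hQP ↦ ?_
    have hP0 : (P : MvPolynomial (Fin n) ℂ) ≠ 0 := by simpa using hP.ne_zero
    rw [squarefree_iff_irreducible_sq_not_dvd_of_ne_zero hP0] at hsq
    push Not at hsq
    obtain ⟨R, hR, hRP⟩ := hsq
    rw [← sq] at hRP
    have hRcomap := hcomap P hP R hR ((dvd_pow_self R two_ne_zero).trans hRP)
    have hPD : P ∣ ⟨_, hD⟩ := by
      rw [← Ideal.mem_span_singleton, ← hRcomap, Ideal.mem_comap, Ideal.mem_span_singleton]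
      exact hdvdD R (isRamified_of_sq_dvd hP hR hRcomap hRP)
    have hQD : Q ∣ ∏ Q ∈ S, Q ^ eIdx Q := hQP.trans (map_dvd A.val hPD)
    obtain ⟨Q', hQ'S, hQQ'⟩ := hQ.prime.exists_mem_finset_dvd hQD
    obtain ⟨hQ', hram, he⟩ := hS₁ Q' hQ'S
    have hass : Associated Q Q' := hQ.associated_of_dvd hQ' (hQ.prime.dvd_of_dvd_pow hQQ')
    have hmult := hram.multIs (hcomap P hP Q' hQ' (hass.symm.dvd.trans hQP))
    exact (hass.pow_pow.dvd.trans (pow_dvd_pow Q' he)).trans hmult.1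
  · intro h
    rw [← Finset.prod_fiberwise_of_maps_to
      (g := fun Q ↦ (Ideal.span {Q}).comap (algebraMap A (MvPolynomial (Fin n) ℂ)))
      (t := S.image fun Q ↦
        (Ideal.span {Q}).comap (algebraMap A (MvPolynomial (Fin n) ℂ)))
      (fun Q hQ ↦ Finset.mem_image.2 ⟨Q, hQ, rfl⟩)]
    refine A.prod_mem fun I hI ↦ ?_
    obtain ⟨Q₀, hQ₀S, rfl⟩ := Finset.mem_image.1 hI
    obtain ⟨hQ₀, hram₀, he₀⟩ := hS₁ Q₀ hQ₀S
    obtain ⟨P, hP, hPcomap, hPmult⟩ := id hram₀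
    have hall : ∀ Q : MvPolynomial (Fin n) ℂ, Irreducible Q →
        Q ∣ (P : MvPolynomial (Fin n) ℂ) → Q ^ 2 ∣ (P : MvPolynomial (Fin n) ℂ) := by
      refine (h P hP).resolve_left fun hsq ↦ hQ₀.not_isUnit (hsq Q₀ ?_)
      rw [← sq]
      exact (pow_dvd_pow Q₀ he₀).trans hPmult.1
    rw [hPcomap]
    obtain ⟨c, hc⟩ : (∏ Q ∈ S with (Ideal.span {Q}).comap
        (algebraMap A (MvPolynomial (Fin n) ℂ)) = Ideal.span {P}, Q ^ eIdx Q) ∣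
        (P : MvPolynomial (Fin n) ℂ) := by
      refine Finset.prod_dvd_of_isRelPrime (fun Q hQ Q' hQ' hne ↦ ?_) fun Q hQ ↦ ?_
      · rw [Finset.mem_coe, Finset.mem_filter] at hQ hQ'
        have hirr := (hS₁ Q hQ.1).1
        refine IsRelPrime.pow (hirr.isRelPrime_iff_not_dvd.2 fun hd ↦
          hS₂ Q hQ.1 Q' hQ'.1 hne (hirr.associated_of_dvd (hS₁ Q' hQ'.1).1 hd))
      · rw [Finset.mem_filter] at hQ
        exact ((hS₁ Q hQ.1).2.1.multIs hQ.2).1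
    refine MvPolynomial.mem_subalgebra_of_isUnit_mul_mem (c := c) ?_ (hc ▸ P.2)
    by_contra hcu
    have hP0 : (P : MvPolynomial (Fin n) ℂ) ≠ 0 := by simpa using hP.ne_zero
    have hc0 : c ≠ 0 := by
      rintro rfl
      exact hP0 (by rw [hc, mul_zero])
    obtain ⟨R, hR, hRc⟩ := WfDvdMonoid.exists_irreducible_factor hcu hc0
    have hRP : R ∣ (P : MvPolynomial (Fin n) ℂ) := hRc.trans (hc ▸ dvd_mul_left _ _)
    obtain ⟨Q, ⟨hQS, hRQ⟩, -⟩ :=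
      hS₃ R (isRamified_of_sq_dvd hP hR (hcomap P hP R hR hRP) (hall R hR hRP))
    have hQcomap := hcomap P hP Q (hS₁ Q hQS).1 (hRQ.symm.dvd.trans hRP)
    refine ((hS₁ Q hQS).2.1.multIs hQcomap).2 ?_
    rw [hc, pow_succ]
    exact mul_dvd_mul (Finset.dvd_prod_of_mem (fun Q ↦ Q ^ eIdx Q)
      (Finset.mem_filter.2 ⟨hQS, hQcomap⟩)) (hRQ.symm.dvd.trans hRc)
end
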